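/- arXiv:math/0505385 — 2 statements merged into one kernel-verified Lean document; each statement's English description precedes it below -/
import Mathlib

section
/- Let α, β, γ, σ be arbitrary real numbers and let A be the operator Au := −v·∇_x u + β div_v(v u) + σ Δ_v u + 2γ div_v(∇_x u) + α Δ_x u. Let Z := L²(ℝ⁶; (1+|x|²+|v|²)² dx dv). Suppose f, g ∈ Z satisfy, for every test function φ ∈ C_c^∞(ℝ³×ℝ³), ∫∫ f · ( v·∇_x φ − β v·∇_v φ + σ Δ_v φ + 2γ div_v(∇_x φ) + α Δ_x φ ) dx dv = ∫∫ g φ dx dv (i.e. the distributional identity Af = g holds). Then there exists a sequence (f_n) ⊂ C_c^∞(ℝ³×ℝ³) such that ‖f_n − f‖_Z → 0 and ‖A f_n − g‖_Z → 0 as n → ∞. -/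
open MeasureTheory Real Filter ENNReal

noncomputable section

abbrev E3 := EuclideanSpace ℝ (Fin 3)

/-- The `i`-th standard basis vector of `ℝ³`. -/
def e3 (i : Fin 3) : E3 := EuclideanSpace.single i 1

/-- The quantum Fokker-Planck generator
`Au = −v·∇_x u + β div_v(v u) + σ Δ_v u + 2γ div_v(∇_x u) + α Δ_x u`. -/
def Aop (α β γ σ : ℝ) (u : E3 × E3 → ℝ) (p : E3 × E3) : ℝ :=
  -(∑ i : Fin 3, p.2 i * fderiv ℝ u p (e3 i, 0))
    + β * (∑ i : Fin 3, fderiv ℝ (fun q : E3 × E3 => q.2 i * u q) p (0, e3 i))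
    + σ * (∑ i : Fin 3, fderiv ℝ (fun q => fderiv ℝ u q (0, e3 i)) p (0, e3 i))
    + 2 * γ * (∑ i : Fin 3, fderiv ℝ (fun q => fderiv ℝ u q (e3 i, 0)) p (0, e3 i))
    + α * (∑ i : Fin 3, fderiv ℝ (fun q => fderiv ℝ u q (e3 i, 0)) p (e3 i, 0))

/-- The formal adjoint of `A` (acting on test functions):
`A*φ = v·∇_x φ − β v·∇_v φ + σ Δ_v φ + 2γ div_v(∇_x φ) + α Δ_x φ`. -/
def AopStar (α β γ σ : ℝ) (φ : E3 × E3 → ℝ) (p : E3 × E3) : ℝ :=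
  (∑ i : Fin 3, p.2 i * fderiv ℝ φ p (e3 i, 0))
    - β * (∑ i : Fin 3, p.2 i * fderiv ℝ φ p (0, e3 i))
    + σ * (∑ i : Fin 3, fderiv ℝ (fun q => fderiv ℝ φ q (0, e3 i)) p (0, e3 i))
    + 2 * γ * (∑ i : Fin 3, fderiv ℝ (fun q => fderiv ℝ φ q (e3 i, 0)) p (0, e3 i))
    + α * (∑ i : Fin 3, fderiv ℝ (fun q => fderiv ℝ φ q (e3 i, 0)) p (e3 i, 0))

/-- The norm of the weighted space `Z = L²(ℝ⁶; (1+|x|²+|v|²)² dx dv)`. -/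
def Znorm (f : E3 × E3 → ℝ) : ℝ≥0∞ :=
  (∫⁻ p : E3 × E3, (‖f p‖₊ : ℝ≥0∞) ^ 2 *
      ENNReal.ofReal ((1 + ‖p.1‖ ^ 2 + ‖p.2‖ ^ 2) ^ 2)) ^ (1/2 : ℝ)

instance isAddHaarMeasure_volume_E3_prod :
    (volume : Measure (E3 × E3)).IsAddHaarMeasure :=
  inferInstanceAs (Measure.IsAddHaarMeasure ((volume : Measure E3).prod (volume : Measure E3)))

instance isNegInvariant_volume_E3_prod : (volume : Measure (E3 × E3)).IsNegInvariant :=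
  Measure.IsAddHaarMeasure.isNegInvariant_of_regular _

/-- The square root of the weight defining `Z`. -/
def wt (p : E3 × E3) : ℝ := 1 + ‖p.1‖ ^ 2 + ‖p.2‖ ^ 2

lemma wt_pos (p : E3 × E3) : 0 < wt p := by unfold wt; positivity

lemma continuous_wt : Continuous wt := by unfold wt; fun_prop

lemma Znorm_eq_eLpNorm (f : E3 × E3 → ℝ) :
    Znorm f = eLpNorm (fun p => wt p * f p) 2 volume := by
  rw [eLpNorm_eq_lintegral_rpow_enorm_toReal (by norm_num) (by norm_num)]
  unfold Znorm
  congr 1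
  refine lintegral_congr fun p => ?_
  rw [enorm_mul, Real.enorm_eq_ofReal (wt_pos p).le]
  simp only [ENNReal.toReal_ofNat, ENNReal.rpow_two, mul_pow]
  rw [ENNReal.ofReal_pow (by positivity), mul_comm]
  rfl

lemma tendsto_eLpNorm_translate {F : E3 × E3 → ℝ} (hF : MemLp F 2 volume) :
    Tendsto (fun z => eLpNorm (fun p => F (p - z) - F p) 2 volume) (nhds (0 : E3 × E3))
      (nhds 0) := by
  have hmp : ∀ z : E3 × E3, MeasurePreserving (fun p : E3 × E3 => p - z) volume volume :=
    fun z => measurePreserving_sub_right volume z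
  let g : C(E3 × E3, C(E3 × E3, E3 × E3)) :=
    (ContinuousMap.mk (fun a : (E3 × E3) × (E3 × E3) => a.2 - a.1)
      (continuous_snd.sub continuous_fst)).curry
  have hc := Continuous.compMeasurePreservingLp (p := 2) (continuous_const (y := hF.toLp F))
    g.continuous hmp (by norm_num)
  have h0 := (hc.tendsto 0).edist (tendsto_const_nhds (x := hF.toLp F))
  have e0 : ∀ z, edist (Lp.compMeasurePreserving (g z) (hmp z) (hF.toLp F)) (hF.toLp F)
      = eLpNorm (fun p => F (p - z) - F p) 2 volume := by
    intro z
    exact (congrArg (fun G => edist G (hF.toLp F))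
      (Lp.toLp_compMeasurePreserving hF (hmp z))).trans
        (Lp.edist_toLp_toLp _ _ (hF.comp_measurePreserving (hmp z)) hF)
  simp only [e0] at h0
  simpa using h0

lemma wt_sub_abs_le (p z : E3 × E3) : |wt p - wt (p - z)| ≤ 4 * (‖z‖ + ‖z‖ ^ 2) * wt (p - z) := by
  have key : ∀ a b : E3, ‖b‖ ≤ ‖z‖ → |‖a‖ ^ 2 - ‖a - b‖ ^ 2| ≤ ‖z‖ * (1 + ‖a - b‖ ^ 2) + ‖z‖ ^ 2 := by
    intro a b hb
    have h1 : |‖a‖ - ‖a - b‖| ≤ ‖b‖ := by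
      simpa using abs_norm_sub_norm_le a (a - b)
    have h2 : ‖a‖ + ‖a - b‖ ≤ 2 * ‖a - b‖ + ‖b‖ := by
      have := abs_le.1 h1
      linarith
    rw [show ‖a‖ ^ 2 - ‖a - b‖ ^ 2 = (‖a‖ - ‖a - b‖) * (‖a‖ + ‖a - b‖) by ring, abs_mul,
      abs_of_nonneg (by positivity : 0 ≤ ‖a‖ + ‖a - b‖)]
    calc _ ≤ ‖z‖ * (2 * ‖a - b‖ + ‖z‖) := by
          exact mul_le_mul (h1.trans hb) (h2.trans (by linarith)) (by positivity) (norm_nonneg z)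
      _ ≤ _ := by nlinarith [norm_nonneg z, sq_nonneg (‖a - b‖ - 1), mul_nonneg (norm_nonneg z) (sq_nonneg (‖a - b‖ - 1))]
  have h1 := key p.1 z.1 (norm_fst_le z)
  have h2 := key p.2 z.2 (norm_snd_le z)
  have : wt p - wt (p - z) = (‖p.1‖ ^ 2 - ‖p.1 - z.1‖ ^ 2) + (‖p.2‖ ^ 2 - ‖p.2 - z.2‖ ^ 2) := by
    simp only [wt, Prod.fst_sub, Prod.snd_sub]; ring
  rw [this]
  refine (abs_add_le _ _).trans ((add_le_add h1 h2).trans ?_)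
  simp only [wt, Prod.fst_sub, Prod.snd_sub]
  have := norm_nonneg z
  nlinarith [mul_nonneg this (sq_nonneg ‖p.1 - z.1‖), mul_nonneg this (sq_nonneg ‖p.2 - z.2‖),
    mul_nonneg (sq_nonneg ‖z‖) (sq_nonneg ‖p.1 - z.1‖),
    mul_nonneg (sq_nonneg ‖z‖) (sq_nonneg ‖p.2 - z.2‖)]

lemma Znorm_translate_sub_le {f : E3 × E3 → ℝ} (hf : Measurable f) (z : E3 × E3) :
    Znorm (fun p => f (p - z) - f p) ≤
      eLpNorm (fun p => wt (p - z) * f (p - z) - wt p * f p) 2 volume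
        + ENNReal.ofReal (4 * (‖z‖ + ‖z‖ ^ 2)) * Znorm f := by
  have hw := continuous_wt.measurable
  rw [Znorm_eq_eLpNorm]
  have e : (fun p => wt p * (f (p - z) - f p)) = (fun p => wt (p - z) * f (p - z) - wt p * f p)
      + fun p => (wt p - wt (p - z)) * f (p - z) := by
    funext p; simp only [Pi.add_apply]; ring
  rw [e]
  refine (eLpNorm_add_le (by fun_prop) (by fun_prop) (by norm_num)).trans ?_
  refine add_le_add_right ?_ _
  rw [Znorm_eq_eLpNorm,
    ← eLpNorm_comp_measurePreserving (g := fun p => wt p * f p) (f := fun p => p - z)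
      (by fun_prop) (measurePreserving_sub_right volume z)]
  refine eLpNorm_le_mul_eLpNorm_of_ae_le_mul (Eventually.of_forall fun p => ?_) 2
  simp only [Function.comp, norm_mul, Real.norm_eq_abs, abs_of_pos (wt_pos _)]
  rw [← mul_assoc]
  gcongr
  exact wt_sub_abs_le p z

lemma memLp_wt_mul {f : E3 × E3 → ℝ} (hf : Measurable f) (h : Znorm f < ⊤) :
    MemLp (fun p => wt p * f p) 2 volume :=
  ⟨(continuous_wt.measurable.mul hf).aestronglyMeasurable, by rwa [← Znorm_eq_eLpNorm]⟩

lemma tendsto_Znorm_translate {f : E3 × E3 → ℝ} (hf : Measurable f) (h : Znorm f < ⊤) :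
    Tendsto (fun z => Znorm (fun p => f (p - z) - f p)) (nhds (0 : E3 × E3)) (nhds 0) := by
  refine tendsto_of_tendsto_of_tendsto_of_le_of_le tendsto_const_nhds ?_ (fun _ => zero_le)
    (fun z => Znorm_translate_sub_le hf z)
  have h1 := tendsto_eLpNorm_translate (memLp_wt_mul hf h)
  have h2 : Tendsto (fun z : E3 × E3 => ENNReal.ofReal (4 * (‖z‖ + ‖z‖ ^ 2)) * Znorm f)
      (nhds 0) (nhds 0) := by
    have : Tendsto (fun z : E3 × E3 => ENNReal.ofReal (4 * (‖z‖ + ‖z‖ ^ 2))) (nhds 0) (nhds 0) := by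
      have hc : Continuous fun z : E3 × E3 => ENNReal.ofReal (4 * (‖z‖ + ‖z‖ ^ 2)) :=
        ENNReal.continuous_ofReal.comp (by fun_prop)
      simpa using hc.tendsto 0
    simpa using ENNReal.Tendsto.mul_const this (Or.inr h.ne)
  simpa using h1.add h2

lemma Znorm_translate_sub_bound {f : E3 × E3 → ℝ} (hf : Measurable f) (z : E3 × E3) :
    Znorm (fun p => f (p - z) - f p) ≤
      (2 + ENNReal.ofReal (4 * (‖z‖ + ‖z‖ ^ 2))) * Znorm f := by
  have hw := continuous_wt.measurable
  refine (Znorm_translate_sub_le hf z).trans ?_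
  rw [add_mul]
  gcongr
  refine (eLpNorm_sub_le (f := fun p => wt (p - z) * f (p - z)) (by fun_prop) (by fun_prop)
    (by norm_num)).trans ?_
  have := eLpNorm_comp_measurePreserving (p := 2) (g := fun p => wt p * f p) (f := fun p => p - z)
      (by fun_prop) (measurePreserving_sub_right volume z)
  rw [Function.comp_def] at this
  rw [this, Znorm_eq_eLpNorm, two_mul]

lemma Znorm_mono {f g : E3 × E3 → ℝ} (h : ∀ p, |f p| ≤ |g p|) : Znorm f ≤ Znorm g := by
  rw [Znorm_eq_eLpNorm, Znorm_eq_eLpNorm]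
  refine eLpNorm_mono fun p => ?_
  simp only [norm_mul, Real.norm_eq_abs]
  exact mul_le_mul_of_nonneg_left (h p) (abs_nonneg _)

lemma Znorm_add_le {f g : E3 × E3 → ℝ} (hf : Measurable f) (hg : Measurable g) :
    Znorm (fun p => f p + g p) ≤ Znorm f + Znorm g := by
  have hw := continuous_wt.measurable
  simp only [Znorm_eq_eLpNorm]
  have e : (fun p => wt p * (f p + g p)) = (fun p => wt p * f p) + fun p => wt p * g p := by
    funext p; simp only [Pi.add_apply]; ring
  rw [e]
  exact eLpNorm_add_le (by fun_prop) (by fun_prop) (by norm_num)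

lemma Znorm_const_mul (c : ℝ) (f : E3 × E3 → ℝ) :
    Znorm (fun p => c * f p) = ‖c‖ₑ * Znorm f := by
  simp only [Znorm_eq_eLpNorm]
  rw [← eLpNorm_const_smul]
  congr 1
  funext p
  simp only [Pi.smul_apply, smul_eq_mul]
  ring

lemma Znorm_sq (f : E3 × E3 → ℝ) :
    Znorm f ^ 2 = ∫⁻ p : E3 × E3, ‖f p‖ₑ ^ 2 * ENNReal.ofReal (wt p ^ 2) := by
  unfold Znorm
  rw [← ENNReal.rpow_natCast, ← ENNReal.rpow_mul]
  norm_num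
  rfl

lemma locallyIntegrable_of_Znorm {f : E3 × E3 → ℝ} (hf : Measurable f) (h : Znorm f < ⊤) :
    LocallyIntegrable f volume := by
  have h2 : MemLp f 2 volume := by
    refine (memLp_wt_mul hf h).mono hf.aestronglyMeasurable (Eventually.of_forall fun p => ?_)
    rw [norm_mul, Real.norm_eq_abs (wt p), abs_of_pos (wt_pos p)]
    refine le_mul_of_one_le_left (norm_nonneg _) ?_
    unfold wt
    nlinarith [sq_nonneg ‖p.1‖, sq_nonneg ‖p.2‖]
  exact h2.locallyIntegrable (by norm_num)

/-- Convolution of real functions on phase space. -/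
def cv (f k : E3 × E3 → ℝ) : E3 × E3 → ℝ :=
  convolution f k (ContinuousLinearMap.mul ℝ ℝ) volume

lemma cv_apply (f k : E3 × E3 → ℝ) (p : E3 × E3) : cv f k p = ∫ t, f t * k (p - t) := rfl

lemma integrable_cv {f k : E3 × E3 → ℝ} (hf : LocallyIntegrable f volume) (hk : Continuous k)
    (hck : HasCompactSupport k) (p : E3 × E3) : Integrable (fun t => f t * k (p - t)) volume :=
  hck.convolutionExists_right (ContinuousLinearMap.mul ℝ ℝ) hf hk p

lemma cv_sub_eq {f k : E3 × E3 → ℝ} (hf : LocallyIntegrable f volume) (hk : Continuous k)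
    (hck : HasCompactSupport k) (p : E3 × E3) :
    cv f k p - (∫ z, k z) * f p = ∫ z, k z * (f (p - z) - f p) := by
  have h1 : Integrable (fun t => f (p - t) * k t) volume :=
    (hck.convolutionExists_right (ContinuousLinearMap.mul ℝ ℝ) hf hk p).integrable_swap
  have h2 : cv f k p = ∫ t, f (p - t) * k t := convolution_eq_swap _
  rw [h2, ← integral_mul_const, ← integral_sub h1 ((hk.integrable_of_hasCompactSupport hck).mul_const _)]
  refine integral_congr_ae (Eventually.of_forall fun z => ?_)
  simp only; ring

lemma lintegral_mul_sq_le {a b : E3 × E3 → ℝ≥0∞} (ha : Measurable a) (hb : Measurable b) :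
    (∫⁻ z, a z * b z) ^ 2 ≤ (∫⁻ z, a z) * ∫⁻ z, a z * b z ^ 2 := by
  have h := ENNReal.lintegral_mul_le_Lp_mul_Lq (volume.withDensity a) Real.HolderConjugate.two_two
    (f := fun _ => 1) (g := b) aemeasurable_const hb.aemeasurable
  simp only [Pi.mul_apply, one_mul, ENNReal.rpow_two, one_pow] at h
  rw [lintegral_withDensity_eq_lintegral_mul _ ha hb,
    lintegral_withDensity_eq_lintegral_mul _ ha (hb.pow_const 2),
    lintegral_withDensity_eq_lintegral_mul _ ha measurable_const] at h
  simp only [Pi.mul_apply, mul_one] at h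
  calc _ ≤ _ := pow_le_pow_left₀ zero_le h 2
    _ = _ := by
      rw [mul_pow, ← ENNReal.rpow_mul_natCast, ← ENNReal.rpow_mul_natCast]
      norm_num

lemma measurable_cv {f k : E3 × E3 → ℝ} (hf : LocallyIntegrable f volume) (hk : Continuous k)
    (hck : HasCompactSupport k) : Measurable (cv f k) :=
  (hck.continuous_convolution_right _ hf hk).measurable

lemma Znorm_cv_sub_le {f k : E3 × E3 → ℝ} (hf : Measurable f) (h : Znorm f < ⊤)
    (hk : Continuous k) (hck : HasCompactSupport k) {S : ℝ≥0∞}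
    (hS : ∀ z, k z ≠ 0 → Znorm (fun p => f (p - z) - f p) ≤ S) :
    Znorm (fun p => cv f k p - (∫ z, k z) * f p) ≤ (∫⁻ z, ‖k z‖ₑ) * S := by
  have hkm := hk.measurable
  have hwm := continuous_wt.measurable
  rw [← ENNReal.pow_le_pow_left_iff (n := 2) (by norm_num), Znorm_sq]
  have hp : ∀ p, ‖cv f k p - (∫ z, k z) * f p‖ₑ ^ 2 ≤
      (∫⁻ z, ‖k z‖ₑ) * ∫⁻ z, ‖k z‖ₑ * ‖f (p - z) - f p‖ₑ ^ 2 := by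
    intro p
    rw [cv_sub_eq (locallyIntegrable_of_Znorm hf h) hk hck]
    refine (pow_le_pow_left₀ zero_le (enorm_integral_le_lintegral_enorm _) 2).trans ?_
    simp only [enorm_mul]
    exact lintegral_mul_sq_le (by fun_prop) (by fun_prop)
  calc _ ≤ ∫⁻ p, (∫⁻ z, ‖k z‖ₑ) * ∫⁻ z, ‖k z‖ₑ *
          (‖f (p - z) - f p‖ₑ ^ 2 * ENNReal.ofReal (wt p ^ 2)) := by
        refine lintegral_mono fun p => ?_
        refine (mul_le_mul_left (hp p) _).trans (le_of_eq ?_)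
        rw [mul_assoc]
        congr 1
        rw [← lintegral_mul_const _ (by fun_prop)]
        exact lintegral_congr fun z => mul_assoc _ _ _
    _ = (∫⁻ z, ‖k z‖ₑ) * ∫⁻ z, ‖k z‖ₑ * Znorm (fun p => f (p - z) - f p) ^ 2 := by
        rw [lintegral_const_mul _ (by fun_prop), lintegral_lintegral_swap (by fun_prop)]
        congr 1
        refine lintegral_congr fun z => ?_
        rw [lintegral_const_mul _ (by fun_prop), Znorm_sq]
    _ ≤ (∫⁻ z, ‖k z‖ₑ) * ∫⁻ z, ‖k z‖ₑ * S ^ 2 := by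
        refine mul_le_mul_right (lintegral_mono fun z => ?_) _
        by_cases hz : k z = 0
        · simp [hz]
        · exact mul_le_mul_right (pow_le_pow_left₀ zero_le (hS z hz) 2) _
    _ = _ := by
        rw [lintegral_mul_const _ (by fun_prop), mul_pow, sq (∫⁻ z, ‖k z‖ₑ), mul_assoc]

lemma lintegral_enorm_lt_top {k : E3 × E3 → ℝ} (hk : Continuous k) (hck : HasCompactSupport k) :
    ∫⁻ z, ‖k z‖ₑ < ⊤ :=
  (hk.integrable_of_hasCompactSupport hck).hasFiniteIntegral

lemma Znorm_cv_lt_top {f k : E3 × E3 → ℝ} (hf : Measurable f) (h : Znorm f < ⊤)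
    (hk : Continuous k) (hck : HasCompactSupport k) : Znorm (cv f k) < ⊤ := by
  obtain ⟨r, hr⟩ := hck.isBounded.exists_norm_le
  have hS : ∀ z, k z ≠ 0 → Znorm (fun p => f (p - z) - f p) ≤
      (2 + ENNReal.ofReal (4 * (r + r ^ 2))) * Znorm f := by
    intro z hz
    have := hr z (subset_tsupport _ hz)
    refine (Znorm_translate_sub_bound hf z).trans ?_
    gcongr
  have h1 := Znorm_cv_sub_le hf h hk hck hS
  have e : cv f k = fun p => (cv f k p - (∫ z, k z) * f p) + (∫ z, k z) * f p := by
    funext p; ring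
  have hm := measurable_cv (locallyIntegrable_of_Znorm hf h) hk hck
  rw [e]
  refine (Znorm_add_le (by fun_prop) (by fun_prop)).trans_lt (ENNReal.add_lt_top.2 ⟨?_, ?_⟩)
  · refine h1.trans_lt (ENNReal.mul_lt_top (lintegral_enorm_lt_top hk hck) (ENNReal.mul_lt_top ?_ h))
    exact ENNReal.add_lt_top.2 ⟨by norm_num, ENNReal.ofReal_lt_top⟩
  · rw [Znorm_const_mul]
    exact ENNReal.mul_lt_top enorm_lt_top h

/-- The `L¹`-normalised dilation of a kernel by the factor `c`. -/
def dil (c : ℝ) (k : E3 × E3 → ℝ) (z : E3 × E3) : ℝ := c ^ 6 * k (c • z)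

lemma continuous_dil {c : ℝ} {k : E3 × E3 → ℝ} (hk : Continuous k) : Continuous (dil c k) := by
  unfold dil; fun_prop

lemma hasCompactSupport_dil {c : ℝ} (hc : 0 < c) {k : E3 × E3 → ℝ} (hk : HasCompactSupport k) :
    HasCompactSupport (dil c k) :=
  (hk.comp_smul hc.ne').mul_left

lemma integral_dil {c : ℝ} (hc : 0 < c) (k : E3 × E3 → ℝ) : ∫ z, dil c k z = ∫ z, k z := by
  unfold dil
  rw [integral_const_mul, Measure.integral_comp_smul]
  have : Module.finrank ℝ (E3 × E3) = 6 := by simp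
  rw [this, abs_of_pos (by positivity), smul_eq_mul, ← mul_assoc,
    mul_inv_cancel₀ (by positivity), one_mul]

lemma lintegral_enorm_dil {c : ℝ} (hc : 0 < c) {k : E3 × E3 → ℝ} (hk : Continuous k)
    (hck : HasCompactSupport k) : ∫⁻ z, ‖dil c k z‖ₑ = ∫⁻ z, ‖k z‖ₑ := by
  rw [← ofReal_integral_norm_eq_lintegral_enorm (hk.integrable_of_hasCompactSupport hck),
    ← ofReal_integral_norm_eq_lintegral_enorm
      ((continuous_dil hk).integrable_of_hasCompactSupport (hasCompactSupport_dil hc hck)),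
    ← integral_dil hc (fun z => ‖k z‖)]
  congr 2
  funext z
  simp only [dil, norm_mul, norm_pow, Real.norm_eq_abs, abs_of_pos hc]

lemma tendsto_Znorm_cv_dil {f k : E3 × E3 → ℝ} (hf : Measurable f) (h : Znorm f < ⊤)
    (hk : Continuous k) (hck : HasCompactSupport k) :
    Tendsto (fun n : ℕ => Znorm (fun p => cv f (dil (n + 1) k) p - (∫ z, k z) * f p)) atTop
      (nhds 0) := by
  obtain ⟨r, hr0, hr⟩ := hck.isBounded.exists_pos_norm_le
  set M := ∫⁻ z, ‖k z‖ₑ with hM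
  have hMt : M ≠ ⊤ := (lintegral_enorm_lt_top hk hck).ne
  rw [ENNReal.tendsto_nhds_zero]
  intro ε hε
  obtain ⟨η, hη, hηε⟩ : ∃ η : ℝ≥0∞, 0 < η ∧ M * η ≤ ε := by
    refine ⟨ε / (M + 1), ENNReal.div_pos hε.ne' (by simp [hMt]), ?_⟩
    rw [← mul_div_assoc]
    refine ENNReal.div_le_of_le_mul ?_
    rw [mul_comm]
    gcongr
    exact le_self_add
  have ht := (ENNReal.tendsto_nhds_zero.1 (tendsto_Znorm_translate hf h)) η hη
  obtain ⟨δ, hδ, hball⟩ := Metric.eventually_nhds_iff.1 ht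
  obtain ⟨N, hN⟩ := exists_nat_gt (r / δ)
  filter_upwards [eventually_ge_atTop N] with n hn
  have hc : (0 : ℝ) < n + 1 := by positivity
  have hS : ∀ z, dil (n + 1) k z ≠ 0 → Znorm (fun p => f (p - z) - f p) ≤ η := by
    intro z hz
    refine hball ?_
    have h1 : k (((n : ℝ) + 1) • z) ≠ 0 := right_ne_zero_of_mul hz
    have h2 := hr _ (subset_tsupport _ h1)
    rw [norm_smul, Real.norm_eq_abs, abs_of_pos hc] at h2
    rw [dist_zero_right]
    have h3 : r < δ * (n + 1) := by
      rw [div_lt_iff₀ hδ] at hN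
      have : (N : ℝ) ≤ n := by exact_mod_cast hn
      nlinarith
    by_contra! hcon
    nlinarith
  have := Znorm_cv_sub_le hf h (continuous_dil hk) (hasCompactSupport_dil hc hck) hS
  rw [integral_dil hc, lintegral_enorm_dil hc hk hck] at this
  exact this.trans hηε

/-- The directional derivative of `u` along `a`. -/
def dd (a : E3 × E3) (u : E3 × E3 → ℝ) (p : E3 × E3) : ℝ := fderiv ℝ u p a

/-- Smooth compactly supported functions. -/
def IsTest (φ : E3 × E3 → ℝ) : Prop := ContDiff ℝ (⊤ : ℕ∞) φ ∧ HasCompactSupport φ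

lemma contDiff_dd {u : E3 × E3 → ℝ} (hu : ContDiff ℝ (⊤ : ℕ∞) u) (a : E3 × E3) :
    ContDiff ℝ (⊤ : ℕ∞) (dd a u) :=
  (hu.fderiv_right (m := (⊤ : ℕ∞)) (by simp)).clm_apply contDiff_const

lemma contDiff_coord (i : Fin 3) : ContDiff ℝ (⊤ : ℕ∞) (fun q : E3 × E3 => q.2 i) := by
  fun_prop

lemma differentiable_of_smooth {u : E3 × E3 → ℝ} (hu : ContDiff ℝ (⊤ : ℕ∞) u) :
    Differentiable ℝ u := hu.differentiable (by simp)

lemma IsTest.dd {φ : E3 × E3 → ℝ} (h : IsTest φ) (a : E3 × E3) : IsTest (dd a φ) :=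
  ⟨contDiff_dd h.1 a, h.2.fderiv_apply ℝ a⟩

lemma IsTest.coord_mul {φ : E3 × E3 → ℝ} (h : IsTest φ) (i : Fin 3) :
    IsTest (fun q => q.2 i * φ q) :=
  ⟨(contDiff_coord i).mul h.1, h.2.mul_left⟩

lemma IsTest.continuous {φ : E3 × E3 → ℝ} (h : IsTest φ) : Continuous φ := h.1.continuous

lemma dd_mul {u w : E3 × E3 → ℝ} {p : E3 × E3} (hu : DifferentiableAt ℝ u p)
    (hw : DifferentiableAt ℝ w p) (a : E3 × E3) :
    dd a (fun q => u q * w q) p = u p * dd a w p + w p * dd a u p := by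
  simp [dd, fderiv_fun_mul hu hw]

lemma dd_add {u w : E3 × E3 → ℝ} {p : E3 × E3} (hu : DifferentiableAt ℝ u p)
    (hw : DifferentiableAt ℝ w p) (a : E3 × E3) :
    dd a (fun q => u q + w q) p = dd a u p + dd a w p := by
  simp [dd, fderiv_fun_add hu hw]

lemma dd_coord (i : Fin 3) (a p : E3 × E3) : dd a (fun q : E3 × E3 => q.2 i) p = a.2 i := by
  let L : E3 × E3 →L[ℝ] ℝ :=
    (EuclideanSpace.proj (𝕜 := ℝ) i).comp (ContinuousLinearMap.snd ℝ E3 E3)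
  have : HasFDerivAt (fun q : E3 × E3 => q.2 i) L p := L.hasFDerivAt
  rw [dd, this.fderiv]
  rfl

lemma dd_coord_mul {u : E3 × E3 → ℝ} {p : E3 × E3} (hu : DifferentiableAt ℝ u p)
    (i : Fin 3) (a : E3 × E3) :
    dd a (fun q => q.2 i * u q) p = p.2 i * dd a u p + u p * a.2 i := by
  rw [dd_mul ((contDiff_coord i).differentiable (by simp) p) hu, dd_coord]

lemma dd_velocity_coord_mul {u : E3 × E3 → ℝ} {p : E3 × E3} (hu : DifferentiableAt ℝ u p)
    (i : Fin 3) : dd (0, e3 i) (fun q => q.2 i * u q) p = p.2 i * dd (0, e3 i) u p + u p := by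
  rw [dd_coord_mul hu]; simp [e3]

lemma dd_position_coord_mul {u : E3 × E3 → ℝ} {p : E3 × E3} (hu : DifferentiableAt ℝ u p)
    (i : Fin 3) : dd (e3 i, 0) (fun q => q.2 i * u q) p = p.2 i * dd (e3 i, 0) u p := by
  rw [dd_coord_mul hu]; simp

lemma Aop_eq (α β γ σ : ℝ) {u : E3 × E3 → ℝ} {p : E3 × E3} (hu : DifferentiableAt ℝ u p) :
    Aop α β γ σ u p = -(∑ i : Fin 3, p.2 i * dd (e3 i, 0) u p)
      + β * (∑ i : Fin 3, (p.2 i * dd (0, e3 i) u p + u p))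
      + σ * (∑ i : Fin 3, dd (0, e3 i) (dd (0, e3 i) u) p)
      + 2 * γ * (∑ i : Fin 3, dd (0, e3 i) (dd (e3 i, 0) u) p)
      + α * (∑ i : Fin 3, dd (e3 i, 0) (dd (e3 i, 0) u) p) := by
  rw [← Finset.sum_congr rfl fun i _ => dd_velocity_coord_mul hu i]
  rfl

lemma dd_comp_sub_left {k : E3 × E3 → ℝ} (hk : Differentiable ℝ k) (p a : E3 × E3) :
    dd a (fun t => k (p - t)) = fun t => -dd a k (p - t) := by
  funext t
  have := (hk (p - t)).hasFDerivAt.comp t ((hasFDerivAt_id t).const_sub p)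
  have h2 : fderiv ℝ (fun t => k (p - t)) t = _ := this.fderiv
  simp [dd, h2]

lemma dd_dd_comp_sub_left {k : E3 × E3 → ℝ} (hk : ContDiff ℝ (⊤ : ℕ∞) k) (p a b : E3 × E3) :
    dd b (dd a (fun t => k (p - t))) = fun t => dd b (dd a k) (p - t) := by
  rw [dd_comp_sub_left (differentiable_of_smooth hk)]
  funext t
  have h := congrFun (dd_comp_sub_left (differentiable_of_smooth (contDiff_dd hk a)) p b) t
  have h2 : dd b (fun t => -dd a k (p - t)) t = -dd b (fun t => dd a k (p - t)) t := by
    simp [dd, fderiv_fun_neg]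
  rw [h2, h, neg_neg]

lemma IsTest.comp_sub_left {k : E3 × E3 → ℝ} (hk : IsTest k) (p : E3 × E3) :
    IsTest (fun t => k (p - t)) :=
  ⟨hk.1.comp (contDiff_const.sub contDiff_id), hk.2.comp_homeomorph (Homeomorph.subLeft p)⟩

lemma contDiff_cv {f k : E3 × E3 → ℝ} (hf : LocallyIntegrable f volume) (hk : IsTest k) :
    ContDiff ℝ (⊤ : ℕ∞) (cv f k) :=
  hk.2.contDiff_convolution_right _ hf hk.1

lemma dd_cv {f k : E3 × E3 → ℝ} (hf : LocallyIntegrable f volume) (hk : IsTest k)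
    (a : E3 × E3) : dd a (cv f k) = cv f (dd a k) := by
  funext p
  have h1 : ContDiff ℝ 1 k := hk.1.of_le (by simp)
  have h := hk.2.hasFDerivAt_convolution_right (ContinuousLinearMap.mul ℝ ℝ) hf h1 p
  have h2 : fderiv ℝ (cv f k) p = _ := h.fderiv
  rw [dd, h2]
  exact convolution_precompR_apply _ hf (hk.2.fderiv ℝ) (h1.continuous_fderiv one_ne_zero) p a

/-- The kernel of the commutator of `A` with the convolution by `ρ`. -/
def commKer (β : ℝ) (ρ : E3 × E3 → ℝ) (z : E3 × E3) : ℝ :=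
  -(∑ i : Fin 3, dd (e3 i, 0) (fun q => q.2 i * ρ q) z)
    + β * ∑ i : Fin 3, dd (0, e3 i) (fun q => q.2 i * ρ q) z

/-- `f * h` is integrable with integral `c`. -/
def HasPairing (f h : E3 × E3 → ℝ) (c : ℝ) : Prop :=
  Integrable (fun t => f t * h t) volume ∧ ∫ t, f t * h t = c

namespace HasPairing

variable {f h k : E3 × E3 → ℝ} {c d : ℝ}

lemma add (h1 : HasPairing f h c) (h2 : HasPairing f k d) :
    HasPairing f (fun t => h t + k t) (c + d) := by
  simp only [HasPairing, mul_add]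
  exact ⟨h1.1.add h2.1, by rw [integral_add h1.1 h2.1, h1.2, h2.2]⟩

lemma const_mul (h1 : HasPairing f h c) (r : ℝ) : HasPairing f (fun t => r * h t) (r * c) := by
  simp only [HasPairing, mul_left_comm _ r]
  exact ⟨h1.1.const_mul r, by rw [integral_const_mul, h1.2]⟩

lemma neg (h1 : HasPairing f h c) : HasPairing f (fun t => -h t) (-c) := by
  simpa using h1.const_mul (-1)

lemma sum {h : Fin 3 → E3 × E3 → ℝ} {c : Fin 3 → ℝ} (h1 : ∀ i, HasPairing f (h i) (c i)) :
    HasPairing f (fun t => ∑ i, h i t) (∑ i, c i) := by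
  simp only [HasPairing, Finset.mul_sum]
  refine ⟨integrable_finsetSum _ fun i _ => (h1 i).1, ?_⟩
  rw [integral_finsetSum _ fun i _ => (h1 i).1]
  exact Finset.sum_congr rfl fun i _ => (h1 i).2

end HasPairing

lemma hasPairing_cv {f k : E3 × E3 → ℝ} (hf : LocallyIntegrable f volume) (hk : IsTest k)
    (p : E3 × E3) : HasPairing f (fun t => k (p - t)) (cv f k p) :=
  ⟨integrable_cv hf hk.continuous hk.2 p, rfl⟩

lemma hasPairing_commKer {f ρ : E3 × E3 → ℝ} (β : ℝ) (hf : LocallyIntegrable f volume)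
    (hρ : IsTest ρ) (p : E3 × E3) :
    HasPairing f (fun t => commKer β ρ (p - t)) (cv f (commKer β ρ) p) := by
  have := ((HasPairing.sum fun i =>
    hasPairing_cv hf ((hρ.coord_mul i).dd (e3 i, 0)) p).neg).add
    ((HasPairing.sum fun i => hasPairing_cv hf ((hρ.coord_mul i).dd (0, e3 i)) p).const_mul β)
  exact ⟨this.1, rfl⟩

lemma AopStar_comp_sub_left (α β γ σ : ℝ) {ρ : E3 × E3 → ℝ} (hρ : IsTest ρ) (p t : E3 × E3) :
    AopStar α β γ σ (fun t => ρ (p - t)) t = (-(∑ i : Fin 3, p.2 i * dd (e3 i, 0) ρ (p - t))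
      + β * (∑ i : Fin 3, (p.2 i * dd (0, e3 i) ρ (p - t) + ρ (p - t)))
      + σ * (∑ i : Fin 3, dd (0, e3 i) (dd (0, e3 i) ρ) (p - t))
      + 2 * γ * (∑ i : Fin 3, dd (0, e3 i) (dd (e3 i, 0) ρ) (p - t))
      + α * (∑ i : Fin 3, dd (e3 i, 0) (dd (e3 i, 0) ρ) (p - t)))
      + -commKer β ρ (p - t) := by
  have hd := differentiable_of_smooth hρ.1
  change (∑ i : Fin 3, t.2 i * dd (e3 i, 0) (fun t => ρ (p - t)) t)
    - β * (∑ i : Fin 3, t.2 i * dd (0, e3 i) (fun t => ρ (p - t)) t)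
    + σ * (∑ i : Fin 3, dd (0, e3 i) (dd (0, e3 i) (fun t => ρ (p - t))) t)
    + 2 * γ * (∑ i : Fin 3, dd (0, e3 i) (dd (e3 i, 0) (fun t => ρ (p - t))) t)
    + α * (∑ i : Fin 3, dd (e3 i, 0) (dd (e3 i, 0) (fun t => ρ (p - t))) t) = _
  simp only [dd_dd_comp_sub_left hρ.1]
  simp only [commKer, dd_comp_sub_left hd,
    dd_velocity_coord_mul (hd _), dd_position_coord_mul (hd _), Fin.sum_univ_three,
    Prod.snd_sub, PiLp.sub_apply]
  ring

lemma Aop_cv (α β γ σ : ℝ) {f g ρ : E3 × E3 → ℝ} (hf : LocallyIntegrable f volume)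
    (hρ : IsTest ρ)
    (hdist : ∀ φ : E3 × E3 → ℝ, ContDiff ℝ (⊤ : ℕ∞) φ → HasCompactSupport φ →
      (∫ p : E3 × E3, f p * AopStar α β γ σ φ p) = ∫ p : E3 × E3, g p * φ p) (p : E3 × E3) :
    Aop α β γ σ (cv f ρ) p = cv g ρ p + cv f (commKer β ρ) p := by
  have hP : ∀ a, HasPairing f (fun t => dd a ρ (p - t)) (cv f (dd a ρ) p) :=
    fun a => hasPairing_cv hf (hρ.dd a) p
  have hPP : ∀ a b, HasPairing f (fun t => dd b (dd a ρ) (p - t)) (cv f (dd b (dd a ρ)) p) :=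
    fun a b => hasPairing_cv hf ((hρ.dd a).dd b) p
  have key := (((((HasPairing.sum fun i => (hP (e3 i, 0)).const_mul (p.2 i)).neg.add
    ((HasPairing.sum fun i =>
      ((hP (0, e3 i)).const_mul (p.2 i)).add (hasPairing_cv hf hρ p)).const_mul β)).add
    ((HasPairing.sum fun i => hPP (0, e3 i) (0, e3 i)).const_mul σ)).add
    ((HasPairing.sum fun i => hPP (e3 i, 0) (0, e3 i)).const_mul (2 * γ))).add
    ((HasPairing.sum fun i => hPP (e3 i, 0) (e3 i, 0)).const_mul α)).add
    (hasPairing_commKer β hf hρ p).neg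
  have h2 := key.2
  simp only [← AopStar_comp_sub_left α β γ σ hρ p] at h2
  have ht := hρ.comp_sub_left p
  rw [hdist _ ht.1 ht.2] at h2
  rw [Aop_eq _ _ _ _ (differentiable_of_smooth (contDiff_cv hf hρ) p)]
  simp only [dd_cv hf hρ, dd_cv hf (hρ.dd _)]
  rw [cv_apply g ρ, h2]
  ring

lemma IsTest.add {φ ψ : E3 × E3 → ℝ} (h1 : IsTest φ) (h2 : IsTest ψ) :
    IsTest (fun q => φ q + ψ q) := ⟨h1.1.add h2.1, h1.2.add h2.2⟩

lemma IsTest.const_mul {φ : E3 × E3 → ℝ} (h1 : IsTest φ) (c : ℝ) :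
    IsTest (fun q => c * φ q) := ⟨contDiff_const.mul h1.1, h1.2.mul_left⟩

lemma isTest_commKer (β : ℝ) {ρ : E3 × E3 → ℝ} (hρ : IsTest ρ) : IsTest (commKer β ρ) := by
  have h : commKer β ρ = fun z => (-1) * ((dd (e3 0, 0) (fun q => q.2 0 * ρ q) z
      + dd (e3 1, 0) (fun q => q.2 1 * ρ q) z) + dd (e3 2, 0) (fun q => q.2 2 * ρ q) z)
      + β * ((dd (0, e3 0) (fun q => q.2 0 * ρ q) z
      + dd (0, e3 1) (fun q => q.2 1 * ρ q) z) + dd (0, e3 2) (fun q => q.2 2 * ρ q) z) := by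
    funext z
    simp only [commKer, Fin.sum_univ_three]; ring
  rw [h]
  have hd := fun i a => (hρ.coord_mul i).dd a
  exact ((((hd _ _).add (hd _ _)).add (hd _ _)).const_mul _).add
    ((((hd _ _).add (hd _ _)).add (hd _ _)).const_mul _)

lemma integral_dd {φ : E3 × E3 → ℝ} (h : IsTest φ) (a : E3 × E3) : ∫ z, dd a φ z = 0 := by
  have hi := h.continuous.integrable_of_hasCompactSupport (μ := volume) h.2
  have hi' := (h.dd a).continuous.integrable_of_hasCompactSupport (μ := volume) (h.dd a).2
  have := integral_mul_fderiv_eq_neg_fderiv_mul_of_integrable (μ := volume) (f := fun _ : E3 × E3 => (1 : ℝ))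
    (g := φ) (v := a) (by simp)
    (by simp only [one_mul]; exact hi') (by simpa only [one_mul] using hi)
    (fun _ _ => by fun_prop) (fun x _ => differentiable_of_smooth h.1 x)
  simpa [dd] using this

lemma integral_commKer (β : ℝ) {ρ : E3 × E3 → ℝ} (hρ : IsTest ρ) :
    ∫ z, commKer β ρ z = 0 := by
  have h : ∀ i a, HasPairing (fun _ => 1) (dd a (fun q => q.2 i * ρ q)) 0 := fun i a => by
    have ht := (hρ.coord_mul i).dd a
    exact ⟨by simpa only [one_mul] using ht.continuous.integrable_of_hasCompactSupport ht.2,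
      by simpa only [one_mul] using integral_dd (hρ.coord_mul i) a⟩
  have key := ((HasPairing.sum fun i => h i (e3 i, 0)).neg.add
    ((HasPairing.sum fun i => h i (0, e3 i)).const_mul β)).2
  simpa [commKer] using key

lemma dd_comp_smul {k : E3 × E3 → ℝ} (hk : Differentiable ℝ k) (c : ℝ) (a : E3 × E3) :
    dd a (fun z => k (c • z)) = fun z => c * dd a k (c • z) := by
  funext z
  have := (hk (c • z)).hasFDerivAt.comp z ((hasFDerivAt_id z).const_smul c)
  have h2 : fderiv ℝ (fun z => k (c • z)) z = _ := this.fderiv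
  simp [dd, h2]

lemma commKer_dil (β : ℝ) (c : ℝ) {ρ : E3 × E3 → ℝ} (hρ : IsTest ρ) :
    commKer β (dil c ρ) = dil c (commKer β ρ) := by
  have h : ∀ i a, dd a (fun q => q.2 i * dil c ρ q) =
      fun z => c ^ 6 * dd a (fun q => q.2 i * ρ q) (c • z) := by
    intro i a
    have e : (fun q : E3 × E3 => q.2 i * dil c ρ q) =
        fun q => (c ^ 5) * (fun q : E3 × E3 => q.2 i * ρ q) (c • q) := by
      funext q
      simp only [dil, Prod.smul_snd, PiLp.smul_apply, smul_eq_mul]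
      ring
    funext z
    have hdd := congrFun (dd_comp_smul (differentiable_of_smooth (hρ.coord_mul i).1) c a) z
    have hs : DifferentiableAt ℝ (fun z : E3 × E3 => (fun q : E3 × E3 => q.2 i * ρ q) (c • z)) z :=
      ((differentiable_of_smooth (hρ.coord_mul i).1).comp (differentiable_id.const_smul c)) z
    rw [e]
    have : dd a (fun q => (c ^ 5) * (fun q : E3 × E3 => q.2 i * ρ q) (c • q)) z =
        c ^ 5 * dd a (fun z => (fun q : E3 × E3 => q.2 i * ρ q) (c • z)) z := by
      simp only [dd]
      rw [fderiv_const_mul hs]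
      rfl
    rw [this, hdd]
    ring
  funext z
  simp only [commKer, h]
  simp only [dil, commKer, ← Finset.mul_sum]
  ring

lemma IsTest.dil {c : ℝ} (hc : 0 < c) {ρ : E3 × E3 → ℝ} (hρ : IsTest ρ) : IsTest (dil c ρ) :=
  ⟨contDiff_const.mul (hρ.1.comp (contDiff_const_smul c)), hasCompactSupport_dil hc hρ.2⟩

lemma dd_eq_zero_of_const_on_ball {φ : E3 × E3 → ℝ} {b : ℝ}
    (h : ∀ p : E3 × E3, ‖p‖ < 1 → φ p = b) (a p : E3 × E3) (hp : ‖p‖ < 1) : dd a φ p = 0 := by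
  have he : φ =ᶠ[nhds p] fun _ => b := by
    filter_upwards [(isOpen_lt continuous_norm continuous_const).mem_nhds hp] with q hq
    exact h q hq
  rw [dd, he.fderiv_eq]
  simp

lemma IsTest.exists_bound {φ : E3 × E3 → ℝ} (h : IsTest φ) : ∃ C, ∀ p, |φ p| ≤ C :=
  h.2.exists_bound_of_continuous h.continuous

lemma dd_dd_mul {u w : E3 × E3 → ℝ} (hu : ContDiff ℝ (⊤ : ℕ∞) u)
    (hw : ContDiff ℝ (⊤ : ℕ∞) w) (a b p : E3 × E3) :
    dd b (dd a (fun q => w q * u q)) p = w p * dd b (dd a u) p + dd b w p * dd a u p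
      + (dd a w p * dd b u p + u p * dd b (dd a w) p) := by
  have hud := differentiable_of_smooth hu
  have hwd := differentiable_of_smooth hw
  have hua := differentiable_of_smooth (contDiff_dd hu a)
  have hwa := differentiable_of_smooth (contDiff_dd hw a)
  have e : dd a (fun q => w q * u q) = fun q => w q * dd a u q + u q * dd a w q := by
    funext q
    exact dd_mul (hwd q) (hud q) a
  rw [e, dd_add (u := fun q => w q * dd a u q) (w := fun q => u q * dd a w q)
    ((hwd.mul hua) p) ((hud.mul hwa) p), dd_mul (hwd p) (hua p),
    dd_mul (hud p) (hwa p)]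
  ring

lemma Aop_mul (α β γ σ : ℝ) {u w : E3 × E3 → ℝ} (hu : ContDiff ℝ (⊤ : ℕ∞) u)
    (hw : ContDiff ℝ (⊤ : ℕ∞) w) (p : E3 × E3) :
    Aop α β γ σ (fun q => w q * u q) p = w p * Aop α β γ σ u p
      + -(∑ i : Fin 3, p.2 i * dd (e3 i, 0) w p * u p)
      + β * (∑ i : Fin 3, p.2 i * dd (0, e3 i) w p * u p)
      + σ * (∑ i : Fin 3, dd (0, e3 i) (dd (0, e3 i) w) p * u p)
      + 2 * γ * (∑ i : Fin 3, dd (0, e3 i) (dd (e3 i, 0) w) p * u p)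
      + α * (∑ i : Fin 3, dd (e3 i, 0) (dd (e3 i, 0) w) p * u p)
      + 2 * σ * (∑ i : Fin 3, dd (0, e3 i) w p * dd (0, e3 i) u p)
      + 2 * γ * (∑ i : Fin 3, dd (e3 i, 0) w p * dd (0, e3 i) u p)
      + 2 * γ * (∑ i : Fin 3, dd (0, e3 i) w p * dd (e3 i, 0) u p)
      + 2 * α * (∑ i : Fin 3, dd (e3 i, 0) w p * dd (e3 i, 0) u p) := by
  have hud := differentiable_of_smooth hu
  have hwd := differentiable_of_smooth hw
  rw [Aop_eq (u := fun q => w q * u q) α β γ σ ((hwd.mul hud) p),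
    Aop_eq α β γ σ (hud p)]
  simp only [dd_dd_mul hu hw, dd_mul (hwd p) (hud p), Fin.sum_univ_three]
  ring

lemma abs_sum_fin_three_le {a : Fin 3 → ℝ} {T : ℝ} (h : ∀ i, |a i| ≤ T) : |∑ i, a i| ≤ 3 * T := by
  refine (Finset.abs_sum_le_sum_abs _ _).trans ((Finset.sum_le_sum fun i _ => h i).trans ?_)
  simp

/-- A pointwise majorant of `A (w u)` up to a constant depending on the multiplier `w`. -/
def majorant (α β γ σ : ℝ) (u : E3 × E3 → ℝ) (p : E3 × E3) : ℝ :=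
  |Aop α β γ σ u p| + |u p| + ∑ i : Fin 3, (|dd (e3 i, 0) u p| + |dd (0, e3 i) u p|)

lemma abs_Aop_mul_le (α β γ σ : ℝ) {u w : E3 × E3 → ℝ} (hu : ContDiff ℝ (⊤ : ℕ∞) u)
    (hw : ContDiff ℝ (⊤ : ℕ∞) w) {C : ℝ} (p : E3 × E3) (h0 : |w p| ≤ C)
    (hX : ∀ i, |dd (e3 i, 0) w p| ≤ C) (hV : ∀ i, |dd (0, e3 i) w p| ≤ C)
    (hvX : ∀ i, |p.2 i * dd (e3 i, 0) w p| ≤ C) (hvV : ∀ i, |p.2 i * dd (0, e3 i) w p| ≤ C)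
    (hVV : ∀ i, |dd (0, e3 i) (dd (0, e3 i) w) p| ≤ C)
    (hVX : ∀ i, |dd (0, e3 i) (dd (e3 i, 0) w) p| ≤ C)
    (hXX : ∀ i, |dd (e3 i, 0) (dd (e3 i, 0) w) p| ≤ C) :
    |Aop α β γ σ (fun q => w q * u q) p| ≤
      (4 + 3 * |β| + 9 * |σ| + 18 * |γ| + 9 * |α|) * (C * majorant α β γ σ u p) := by
  have hC : 0 ≤ C := (abs_nonneg _).trans h0
  set T := C * majorant α β γ σ u p with hT
  have hsum : ∀ i : Fin 3, |dd (e3 i, 0) u p| + |dd (0, e3 i) u p| ≤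
      ∑ i : Fin 3, (|dd (e3 i, 0) u p| + |dd (0, e3 i) u p|) := fun i =>
    Finset.single_le_sum (f := fun i : Fin 3 => |dd (e3 i, 0) u p| + |dd (0, e3 i) u p|)
      (fun _ _ => by positivity) (Finset.mem_univ i)
  have hM : ∀ {a b : ℝ}, |a| ≤ C → |b| ≤ majorant α β γ σ u p → |a * b| ≤ T := by
    intro a b ha hb
    rw [abs_mul]
    exact mul_le_mul ha hb (abs_nonneg _) hC
  have hS0 : 0 ≤ ∑ i : Fin 3, (|dd (e3 i, 0) u p| + |dd (0, e3 i) u p|) := by positivity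
  have mA : |Aop α β γ σ u p| ≤ majorant α β γ σ u p := by
    unfold majorant; linarith [abs_nonneg (u p)]
  have mu : |u p| ≤ majorant α β γ σ u p := by
    unfold majorant; linarith [abs_nonneg (Aop α β γ σ u p)]
  have mX : ∀ i, |dd (e3 i, 0) u p| ≤ majorant α β γ σ u p := fun i => by
    unfold majorant
    linarith [abs_nonneg (u p), abs_nonneg (Aop α β γ σ u p), hsum i, abs_nonneg (dd (0, e3 i) u p)]
  have mV : ∀ i, |dd (0, e3 i) u p| ≤ majorant α β γ σ u p := fun i => by
    unfold majorant
    linarith [abs_nonneg (u p), abs_nonneg (Aop α β γ σ u p), hsum i, abs_nonneg (dd (e3 i, 0) u p)]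
  have hc : ∀ (r : ℝ) {s : ℝ}, |s| ≤ 3 * T → |r * s| ≤ |r| * (3 * T) := fun r s hs => by
    rw [abs_mul]; exact mul_le_mul_of_nonneg_left hs (abs_nonneg r)
  rw [Aop_mul α β γ σ hu hw]
  have t0 := hM h0 mA
  have t1 := abs_sum_fin_three_le fun i => hM (hvX i) mu
  have t2 := hc β (abs_sum_fin_three_le fun i => hM (hvV i) mu)
  have t3 := hc σ (abs_sum_fin_three_le fun i => hM (hVV i) mu)
  have t4 := hc (2 * γ) (abs_sum_fin_three_le fun i => hM (hVX i) mu)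
  have t5 := hc α (abs_sum_fin_three_le fun i => hM (hXX i) mu)
  have t6 := hc (2 * σ) (abs_sum_fin_three_le fun i => hM (hV i) (mV i))
  have t7 := hc (2 * γ) (abs_sum_fin_three_le fun i => hM (hX i) (mV i))
  have t8 := hc (2 * γ) (abs_sum_fin_three_le fun i => hM (hV i) (mX i))
  have t9 := hc (2 * α) (abs_sum_fin_three_le fun i => hM (hX i) (mX i))
  rw [← abs_neg] at t1
  simp only [abs_mul (2 : ℝ), abs_two] at t4 t6 t7 t8 t9
  refine (abs_add_le _ _).trans ((add_le_add ((abs_add_le _ _).trans (add_le_add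
    ((abs_add_le _ _).trans (add_le_add ((abs_add_le _ _).trans (add_le_add
    ((abs_add_le _ _).trans (add_le_add ((abs_add_le _ _).trans (add_le_add
    ((abs_add_le _ _).trans (add_le_add ((abs_add_le _ _).trans (add_le_add
    ((abs_add_le _ _).trans (add_le_add t0 t1)) t2)) t3)) t4)) t5)) t6)) t7)) t8)) t9).trans ?_)
  exact le_of_eq (by ring)

lemma contDiff_comp_smul {k : E3 × E3 → ℝ} (hk : ContDiff ℝ (⊤ : ℕ∞) k) (c : ℝ) :
    ContDiff ℝ (⊤ : ℕ∞) (fun z => k (c • z)) := hk.comp (contDiff_const_smul c)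

lemma dd_dd_comp_smul {k : E3 × E3 → ℝ} (hk : ContDiff ℝ (⊤ : ℕ∞) k) (c : ℝ) (a b : E3 × E3) :
    dd b (dd a (fun z => k (c • z))) = fun z => c ^ 2 * dd b (dd a k) (c • z) := by
  rw [dd_comp_smul (differentiable_of_smooth hk)]
  funext z
  have hs := differentiable_of_smooth (contDiff_comp_smul (contDiff_dd hk a) c) z
  have h1 : dd b (fun z => c * dd a k (c • z)) z = c * dd b (fun z => dd a k (c • z)) z := by
    simp only [dd] at hs ⊢
    rw [fderiv_const_mul hs]
    rfl
  rw [h1, dd_comp_smul (differentiable_of_smooth (contDiff_dd hk a))]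
  ring

lemma exists_abs_Aop_cutoff_le (α β γ σ : ℝ) {χ : E3 × E3 → ℝ} (hχ : IsTest χ) :
    ∃ K : ℝ, ∀ c : ℝ, 0 < c → c ≤ 1 → ∀ u : E3 × E3 → ℝ, ContDiff ℝ (⊤ : ℕ∞) u → ∀ p,
      |Aop α β γ σ (fun q => χ (c • q) * u q) p| ≤ K * majorant α β γ σ u p := by
  obtain ⟨C0, h0⟩ := hχ.exists_bound
  choose CX hX using fun i => (hχ.dd (e3 i, 0)).exists_bound
  choose CV hV using fun i => (hχ.dd (0, e3 i)).exists_bound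
  choose CvX hvX using fun i => ((hχ.dd (e3 i, 0)).coord_mul i).exists_bound
  choose CvV hvV using fun i => ((hχ.dd (0, e3 i)).coord_mul i).exists_bound
  choose CVV hVV using fun i => ((hχ.dd (0, e3 i)).dd (0, e3 i)).exists_bound
  choose CVX hVX using fun i => ((hχ.dd (e3 i, 0)).dd (0, e3 i)).exists_bound
  choose CXX hXX using fun i => ((hχ.dd (e3 i, 0)).dd (e3 i, 0)).exists_bound
  obtain ⟨C, hC⟩ : ∃ C, C0 ≤ C ∧ ∀ i, CX i ≤ C ∧ CV i ≤ C ∧ CvX i ≤ C ∧ CvV i ≤ C ∧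
      CVV i ≤ C ∧ CVX i ≤ C ∧ CXX i ≤ C := by
    have hev : ∀ a : ℝ, ∀ᶠ C in atTop, a ≤ C := eventually_ge_atTop
    refine ((hev C0).and (eventually_all.2 fun i => ?_)).exists
    filter_upwards [hev (CX i), hev (CV i), hev (CvX i), hev (CvV i), hev (CVV i), hev (CVX i),
      hev (CXX i)] with C h1 h2 h3 h4 h5 h6 h7
    exact ⟨h1, h2, h3, h4, h5, h6, h7⟩
  refine ⟨(4 + 3 * |β| + 9 * |σ| + 18 * |γ| + 9 * |α|) * C, fun c hc hc1 u hu p => ?_⟩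
  rw [mul_assoc]
  have hd := differentiable_of_smooth hχ.1
  have hs : ∀ {r x D : ℝ}, 0 ≤ r → r ≤ 1 → |x| ≤ D → D ≤ C → |r * x| ≤ C := by
    intro r x D hr hr1 hx hD
    rw [abs_mul, abs_of_nonneg hr]
    exact (mul_le_of_le_one_left (abs_nonneg x) hr1).trans (hx.trans hD)
  have hcv : ∀ (i : Fin 3) (x : ℝ), p.2 i * (c * x) = (c • p).2 i * x := fun i x => by
    simp only [Prod.smul_snd, PiLp.smul_apply, smul_eq_mul]; ring
  have hc2 : c ^ 2 ≤ 1 := pow_le_one₀ hc.le hc1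
  refine abs_Aop_mul_le α β γ σ hu (contDiff_comp_smul hχ.1 c) p ((h0 _).trans hC.1) ?_ ?_ ?_ ?_
    ?_ ?_ ?_ <;> intro i
  · rw [dd_comp_smul hd]; exact hs hc.le hc1 (hX i _) (hC.2 i).1
  · rw [dd_comp_smul hd]; exact hs hc.le hc1 (hV i _) (hC.2 i).2.1
  · rw [dd_comp_smul hd]; simp only [hcv]; exact (hvX i (c • p)).trans (hC.2 i).2.2.1
  · rw [dd_comp_smul hd]; simp only [hcv]; exact (hvV i (c • p)).trans (hC.2 i).2.2.2.1
  · rw [dd_dd_comp_smul hχ.1]; exact hs (sq_nonneg c) hc2 (hVV i _) (hC.2 i).2.2.2.2.1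
  · rw [dd_dd_comp_smul hχ.1]; exact hs (sq_nonneg c) hc2 (hVX i _) (hC.2 i).2.2.2.2.2.1
  · rw [dd_dd_comp_smul hχ.1]; exact hs (sq_nonneg c) hc2 (hXX i _) (hC.2 i).2.2.2.2.2.2

lemma Aop_cutoff_eq (α β γ σ : ℝ) {χ u : E3 × E3 → ℝ} (hχ : IsTest χ)
    (h1 : ∀ p : E3 × E3, ‖p‖ < 1 → χ p = 1) (hu : ContDiff ℝ (⊤ : ℕ∞) u) {c : ℝ} {p : E3 × E3}
    (hp : ‖c • p‖ < 1) :
    Aop α β γ σ (fun q => χ (c • q) * u q) p = Aop α β γ σ u p := by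
  have hz := fun a => dd_eq_zero_of_const_on_ball h1 a
  have hzz := fun a b => dd_eq_zero_of_const_on_ball (hz a) b
  rw [Aop_mul α β γ σ hu (contDiff_comp_smul hχ.1 c)]
  simp only [dd_comp_smul (differentiable_of_smooth hχ.1), hz _ _ hp, h1 _ hp]
  simp only [← dd_comp_smul (differentiable_of_smooth hχ.1), dd_dd_comp_smul hχ.1, hzz _ _ _ hp]
  simp

lemma tendsto_Znorm_of_dominated {h : ℕ → E3 × E3 → ℝ} {S : E3 × E3 → ℝ}
    (hm : ∀ n, Measurable (h n)) (hb : ∀ n p, |h n p| ≤ |S p|) (hS : Znorm S < ⊤)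
    (h0 : ∀ p, ∀ᶠ n in atTop, h n p = 0) : Tendsto (fun n => Znorm (h n)) atTop (nhds 0) := by
  have hw := continuous_wt.measurable
  have hsq : Tendsto (fun n => Znorm (h n) ^ 2) atTop (nhds 0) := by
    simp only [Znorm_sq]
    have := tendsto_lintegral_of_dominated_convergence (μ := (volume : Measure (E3 × E3)))
      (F := fun n p => ‖h n p‖ₑ ^ 2 * ENNReal.ofReal (wt p ^ 2)) (f := fun _ => 0)
      (fun p => ‖S p‖ₑ ^ 2 * ENNReal.ofReal (wt p ^ 2))
      (fun n => by have := hm n; fun_prop) (fun n => Eventually.of_forall fun p => ?_)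
      (by rw [← Znorm_sq]; exact ENNReal.pow_ne_top hS.ne) (Eventually.of_forall fun p => ?_)
    · simpa using this
    · simp only
      gcongr
      exact enorm_le_iff_norm_le.2 (hb n p)
    · refine tendsto_const_nhds.congr' ?_
      filter_upwards [h0 p] with n hn
      simp [hn]
  have := (ENNReal.continuous_rpow_const (y := (1 / 2 : ℝ))).tendsto 0 |>.comp hsq
  have e : ∀ x : ℝ≥0∞, (x ^ 2) ^ (1 / 2 : ℝ) = x := fun x => by
    rw [← ENNReal.rpow_natCast, ← ENNReal.rpow_mul]; norm_num
  simpa only [Function.comp_def, e, ENNReal.zero_rpow_of_pos (by norm_num : (0 : ℝ) < 1 / 2)]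
    using this

lemma measurable_Aop (α β γ σ : ℝ) {u : E3 × E3 → ℝ} (hu : ContDiff ℝ (⊤ : ℕ∞) u) :
    Measurable (Aop α β γ σ u) := by
  have e : Aop α β γ σ u = _ := funext fun p => Aop_eq α β γ σ (differentiable_of_smooth hu p)
  have h0 := hu.continuous
  have h1 := fun a => (contDiff_dd hu a).continuous
  have h2 := fun a b => (contDiff_dd (contDiff_dd hu a) b).continuous
  rw [e]
  refine Continuous.measurable ?_
  fun_prop

lemma Znorm_abs (f : E3 × E3 → ℝ) : Znorm (fun p => |f p|) = Znorm f :=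
  le_antisymm (Znorm_mono fun _ => (abs_abs _).le) (Znorm_mono fun _ => (abs_abs _).ge)

lemma Znorm_majorant_lt_top (α β γ σ : ℝ) {u : E3 × E3 → ℝ} (hu : ContDiff ℝ (⊤ : ℕ∞) u)
    (h0 : Znorm u < ⊤) (hd : ∀ a, Znorm (dd a u) < ⊤) (hA : Znorm (Aop α β γ σ u) < ⊤) :
    Znorm (majorant α β γ σ u) < ⊤ := by
  have m0 := hu.continuous.measurable
  have m1 := fun a => (contDiff_dd hu a).continuous.measurable
  have m2 := measurable_Aop α β γ σ hu
  have hadd : ∀ {f g : E3 × E3 → ℝ}, Measurable f ∧ Znorm f < ⊤ → Measurable g ∧ Znorm g < ⊤ →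
      Measurable (fun p => f p + g p) ∧ Znorm (fun p => f p + g p) < ⊤ := fun hf hg =>
    ⟨hf.1.add hg.1, (Znorm_add_le hf.1 hg.1).trans_lt (ENNReal.add_lt_top.2 ⟨hf.2, hg.2⟩)⟩
  have habs : ∀ {f : E3 × E3 → ℝ}, Measurable f → Znorm f < ⊤ →
      Measurable (fun p => |f p|) ∧ Znorm (fun p => |f p|) < ⊤ := fun hf h =>
    ⟨hf.norm, by rwa [Znorm_abs]⟩
  have hi := fun i : Fin 3 => hadd (habs (m1 (e3 i, 0)) (hd _)) (habs (m1 (0, e3 i)) (hd _))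
  have := (hadd (hadd (habs m2 hA) (habs m0 h0)) (hadd (hadd (hi 0) (hi 1)) (hi 2))).2
  have e : majorant α β γ σ u = fun p => |Aop α β γ σ u p| + |u p| +
      (|dd (e3 0, 0) u p| + |dd (0, e3 0) u p| + (|dd (e3 1, 0) u p| + |dd (0, e3 1) u p|) +
        (|dd (e3 2, 0) u p| + |dd (0, e3 2) u p|)) := by
    funext p
    simp only [majorant, Fin.sum_univ_three]
  rwa [e]

lemma exists_isTest_eq_one : ∃ χ : E3 × E3 → ℝ, IsTest χ ∧ ∀ p : E3 × E3, ‖p‖ < 1 → χ p = 1 := by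
  let b : ContDiffBump (0 : E3 × E3) := ⟨1, 2, one_pos, one_lt_two⟩
  exact ⟨b, ⟨b.contDiff, b.hasCompactSupport⟩, fun p hp =>
    b.one_of_mem_closedBall (by simpa using hp.le)⟩

lemma exists_isTest_integral_eq_one : ∃ ρ : E3 × E3 → ℝ, IsTest ρ ∧ ∫ z, ρ z = 1 := by
  let b : ContDiffBump (0 : E3 × E3) := ⟨1, 2, one_pos, one_lt_two⟩
  exact ⟨b.normed volume, ⟨b.contDiff_normed, b.hasCompactSupport_normed⟩, b.integral_normed⟩

lemma exists_test_near_of_smooth (α β γ σ : ℝ) {u : E3 × E3 → ℝ} (hu : ContDiff ℝ (⊤ : ℕ∞) u)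
    (h0 : Znorm u < ⊤) (hd : ∀ a, Znorm (dd a u) < ⊤) (hA : Znorm (Aop α β γ σ u) < ⊤)
    {ε : ℝ≥0∞} (hε : 0 < ε) :
    ∃ φ, IsTest φ ∧ Znorm (fun p => φ p - u p) ≤ ε ∧
      Znorm (fun p => Aop α β γ σ φ p - Aop α β γ σ u p) ≤ ε := by
  obtain ⟨χ, hχ, hχ1⟩ := exists_isTest_eq_one
  obtain ⟨K, hK⟩ := exists_abs_Aop_cutoff_le α β γ σ hχ
  obtain ⟨C, hC⟩ := hχ.exists_bound
  let c : ℕ → ℝ := fun n => 1 / ((n : ℝ) + 1)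
  have hc0 : ∀ n, 0 < c n := fun n => Nat.one_div_pos_of_nat
  have hc1 : ∀ n, c n ≤ 1 := fun n => by
    rw [div_le_one (by positivity)]
    linarith [Nat.cast_nonneg (α := ℝ) n]
  let φ : ℕ → E3 × E3 → ℝ := fun n q => χ (c n • q) * u q
  have hφ : ∀ n, IsTest (φ n) := fun n =>
    ⟨(contDiff_comp_smul hχ.1 _).mul hu, (hχ.2.comp_smul (hc0 n).ne').mul_right⟩
  have hsmall : ∀ p : E3 × E3, ∀ᶠ n in atTop, ‖c n • p‖ < 1 := by
    intro p
    have : Tendsto (fun n => ‖c n • p‖) atTop (nhds 0) := by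
      simpa [c] using ((tendsto_one_div_add_atTop_nhds_zero_nat (𝕜 := ℝ)).smul_const p).norm
    exact this.eventually_lt_const one_pos
  have t1 : Tendsto (fun n => Znorm (fun p => φ n p - u p)) atTop (nhds 0) := by
    refine tendsto_Znorm_of_dominated (S := fun p => (C + 1) * u p)
      (fun n => ((hφ n).continuous.sub hu.continuous).measurable) (fun n p => ?_) ?_ fun p => ?_
    · have : φ n p - u p = (χ (c n • p) - 1) * u p := by simp only [φ]; ring
      rw [this, abs_mul, abs_mul]
      refine mul_le_mul_of_nonneg_right ?_ (abs_nonneg _)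
      refine (abs_sub _ _).trans ?_
      rw [abs_one]
      exact (add_le_add_left (hC _) 1).trans (le_abs_self _)
    · rw [Znorm_const_mul]
      exact ENNReal.mul_lt_top enorm_lt_top h0
    · filter_upwards [hsmall p] with n hn
      simp only [φ, hχ1 _ hn, one_mul, sub_self]
  have t2 : Tendsto (fun n => Znorm (fun p => Aop α β γ σ (φ n) p - Aop α β γ σ u p)) atTop
      (nhds 0) := by
    refine tendsto_Znorm_of_dominated (S := fun p => (K + 1) * majorant α β γ σ u p)
      (fun n => (measurable_Aop _ _ _ _ (hφ n).1).sub (measurable_Aop _ _ _ _ hu))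
      (fun n p => ?_) ?_ fun p => ?_
    · have hM : |Aop α β γ σ u p| ≤ majorant α β γ σ u p := by
        unfold majorant
        have : 0 ≤ ∑ i : Fin 3, (|dd (e3 i, 0) u p| + |dd (0, e3 i) u p|) := by positivity
        linarith [abs_nonneg (u p)]
      refine (abs_sub _ _).trans ((add_le_add (hK _ (hc0 n) (hc1 n) u hu p) hM).trans ?_)
      refine le_trans (le_of_eq ?_) (le_abs_self _)
      ring
    · rw [Znorm_const_mul]
      exact ENNReal.mul_lt_top enorm_lt_top (Znorm_majorant_lt_top α β γ σ hu h0 hd hA)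
    · filter_upwards [hsmall p] with n hn
      rw [Aop_cutoff_eq α β γ σ hχ hχ1 hu hn, sub_self]
  obtain ⟨n, hn1, hn2⟩ := ((ENNReal.tendsto_nhds_zero.1 t1 ε hε).and
    (ENNReal.tendsto_nhds_zero.1 t2 ε hε)).exists
  exact ⟨φ n, hφ n, hn1, hn2⟩

lemma exists_test_near (α β γ σ : ℝ) {f g : E3 × E3 → ℝ}
    (hf : Measurable f) (hfZ : Znorm f < ⊤) (hg : Measurable g) (hgZ : Znorm g < ⊤)
    (hdist : ∀ φ : E3 × E3 → ℝ, ContDiff ℝ (⊤ : ℕ∞) φ → HasCompactSupport φ →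
      (∫ p : E3 × E3, f p * AopStar α β γ σ φ p) = ∫ p : E3 × E3, g p * φ p)
    {ε : ℝ≥0∞} (hε : 0 < ε) :
    ∃ φ, IsTest φ ∧ Znorm (fun p => φ p - f p) ≤ ε ∧
      Znorm (fun p => Aop α β γ σ φ p - g p) ≤ ε := by
  obtain ⟨ρ, hρ, hρ1⟩ := exists_isTest_integral_eq_one
  have hfl := locallyIntegrable_of_Znorm hf hfZ
  have hgl := locallyIntegrable_of_Znorm hg hgZ
  have hκ := isTest_commKer β hρ
  have hε3 : 0 < ε / 3 := ENNReal.div_pos hε.ne' (by norm_num)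
  have h3 : ε / 3 + ε / 3 + ε / 3 = ε := ENNReal.add_thirds ε
  have l1 := ENNReal.tendsto_nhds_zero.1 (tendsto_Znorm_cv_dil hf hfZ hρ.continuous hρ.2) _ hε3
  have l2 := ENNReal.tendsto_nhds_zero.1 (tendsto_Znorm_cv_dil hg hgZ hρ.continuous hρ.2) _ hε3
  have l3 := ENNReal.tendsto_nhds_zero.1 (tendsto_Znorm_cv_dil hf hfZ hκ.continuous hκ.2) _ hε3
  obtain ⟨n, ⟨h1, h2⟩, h4⟩ := ((l1.and l2).and l3).exists
  have hc : (0 : ℝ) < n + 1 := by positivity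
  simp only [hρ1, integral_commKer β hρ, one_mul, zero_mul, sub_zero] at h1 h2 h4
  have hρn : IsTest (dil (n + 1) ρ) := hρ.dil hc
  have hκn : IsTest (dil (n + 1) (commKer β ρ)) := hκ.dil hc
  set u := cv f (dil (n + 1) ρ) with hu_def
  have hu : ContDiff ℝ (⊤ : ℕ∞) u := contDiff_cv hfl hρn
  have hAu : Aop α β γ σ u = fun p => cv g (dil (n + 1) ρ) p + cv f (dil (n + 1) (commKer β ρ)) p := by
    funext p
    rw [hu_def, Aop_cv α β γ σ hfl hρn hdist, commKer_dil β _ hρ]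
  have mg := measurable_cv hgl hρn.continuous hρn.2
  have mk := measurable_cv hfl hκn.continuous hκn.2
  have hAZ : Znorm (Aop α β γ σ u) < ⊤ := by
    rw [hAu]
    exact (Znorm_add_le mg mk).trans_lt (ENNReal.add_lt_top.2
      ⟨Znorm_cv_lt_top hg hgZ hρn.continuous hρn.2, Znorm_cv_lt_top hf hfZ hκn.continuous hκn.2⟩)
  obtain ⟨φ, hφ, hφ1, hφ2⟩ := exists_test_near_of_smooth α β γ σ hu
    (Znorm_cv_lt_top hf hfZ hρn.continuous hρn.2)
    (fun a => by
      rw [hu_def, dd_cv hfl hρn]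
      exact Znorm_cv_lt_top hf hfZ (hρn.dd a).continuous (hρn.dd a).2) hAZ hε3
  have mφ := hφ.continuous.measurable
  have mu := hu.continuous.measurable
  have mAφ := measurable_Aop α β γ σ hφ.1
  have mAu := measurable_Aop α β γ σ hu
  refine ⟨φ, hφ, ?_, ?_⟩
  · have e : (fun p => φ p - f p) = fun p => (φ p - u p) + (u p - f p) := by funext p; ring
    rw [e, ← h3]
    exact (Znorm_add_le (mφ.sub mu) (mu.sub hf)).trans ((add_le_add hφ1 h1).trans le_self_add)
  · have e : (fun p => Aop α β γ σ φ p - g p) = fun p => ((Aop α β γ σ φ p - Aop α β γ σ u p)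
        + (cv g (dil (n + 1) ρ) p - g p)) + cv f (dil (n + 1) (commKer β ρ)) p := by
      funext p
      rw [hAu]
      ring
    rw [e, ← h3]
    exact (Znorm_add_le ((mAφ.sub mAu).add (mg.sub hg)) mk).trans (add_le_add
      ((Znorm_add_le (mAφ.sub mAu) (mg.sub hg)).trans (add_le_add hφ2 h2)) h4)

/-- Lemma 2.8: if `f, g ∈ Z` satisfy `Af = g` in the distributional sense, then `f` can be
approximated by test functions in the graph norm of `A` on `Z`. -/
theorem graph_density (α β γ σ : ℝ) (f g : E3 × E3 → ℝ)
    (hf : Measurable f) (hfZ : Znorm f < ⊤) (hg : Measurable g) (hgZ : Znorm g < ⊤)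
    (hdist : ∀ φ : E3 × E3 → ℝ, ContDiff ℝ (⊤ : ℕ∞) φ → HasCompactSupport φ →
      (∫ p : E3 × E3, f p * AopStar α β γ σ φ p) = ∫ p : E3 × E3, g p * φ p) :
    ∃ fn : ℕ → E3 × E3 → ℝ,
      (∀ n, ContDiff ℝ (⊤ : ℕ∞) (fn n) ∧ HasCompactSupport (fn n)) ∧
      Tendsto (fun n => Znorm (fun p => fn n p - f p)) atTop (nhds 0) ∧
      Tendsto (fun n => Znorm (fun p => Aop α β γ σ (fn n) p - g p)) atTop (nhds 0) := by
  choose φ hφ h1 h2 using fun n : ℕ => exists_test_near α β γ σ hf hfZ hg hgZ hdist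
    (ε := ((n : ℝ≥0∞) + 1)⁻¹) (by simp)
  have h0 : Tendsto (fun n : ℕ => ((n : ℝ≥0∞) + 1)⁻¹) atTop (nhds 0) := by
    have := (tendsto_add_atTop_iff_nat 1).2 ENNReal.tendsto_inv_nat_nhds_zero
    simpa using this
  exact ⟨φ, hφ,
    tendsto_of_tendsto_of_tendsto_of_le_of_le tendsto_const_nhds h0 (fun _ => zero_le) h1,
    tendsto_of_tendsto_of_tendsto_of_le_of_le tendsto_const_nhds h0 (fun _ => zero_le) h2⟩

end
end

section
/- There exists a constant C > 0 such that for every Schwartz function E : ℝ³ → ℝ, every Schwartz function u on ℝ³×ℝ³, and every s > 0: ‖ x ↦ ∫_{ℝ³} (Γ[E]u)(x − s v, v) dv ‖_{L²(ℝ³_x)} ≤ C s^{-3/2} ‖E‖_{L²(ℝ³)} ‖u‖_{L²(ℝ⁶)}, where Γ[E]u(x,v) := F^{-1}_{η→v}( W(x,η) (F_{v→η}u)(x,η) ) and W(x,η) := ∫_{−1/2}^{1/2} E(x − rη) dr. -/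
open MeasureTheory Real Filter ENNReal RealInnerProductSpace

noncomputable section

/-- `W(x,η) = ∫_{−1/2}^{1/2} E(x − rη) dr` for a scalar function `E`. -/
def Wscal (E : E3 → ℝ) (x η : E3) : ℝ :=
  ∫ r in (-(1/2) : ℝ)..(1/2 : ℝ), E (x - r • η)

/-- Partial Fourier transform in the velocity variable. -/
def fourierV (u : E3 × E3 → ℝ) (x η : E3) : ℂ :=
  ((2 * π : ℝ) ^ (-(3:ℝ)/2) : ℝ) *
    ∫ v : E3, (u (x, v) : ℂ) * Complex.exp (-(Complex.I) * ((⟪v, η⟫ : ℝ) : ℂ))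

/-- The (scalar-kernel) operator `Γ[E]u(x,v) = F⁻¹_{η→v}( W(x,η) (F_{v→η}u)(x,η) )`. -/
def GammaS (E : E3 → ℝ) (u : E3 × E3 → ℝ) (x v : E3) : ℂ :=
  ((2 * π : ℝ) ^ (-(3:ℝ)/2) : ℝ) *
    ∫ η : E3, ((Wscal E x η : ℝ) : ℂ) * fourierV u x η *
      Complex.exp (Complex.I * ((⟪v, η⟫ : ℝ) : ℂ))

section Auxiliary

open FourierTransform SchwartzMap

/-- `‖f‖_{L²}² = ∫ ‖f‖²`, as an identity in `[0, ∞]`. -/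
lemma eLpNorm_two_sq {α F : Type*} [MeasurableSpace α] [NormedAddCommGroup F] (μ : Measure α)
    (f : α → F) : eLpNorm f 2 μ ^ 2 = ∫⁻ x, ‖f x‖ₑ ^ 2 ∂μ := by
  have h := eLpNorm_nnreal_pow_eq_lintegral (f := f) (μ := μ) (p := 2) two_ne_zero
  simpa using h

/-- Cauchy–Schwarz for lower Lebesgue integrals, in squared form. -/
lemma sq_lintegral_mul_le {α : Type*} [MeasurableSpace α] (μ : Measure α) {f g : α → ℝ≥0∞}
    (hf : AEMeasurable f μ) (hg : AEMeasurable g μ) :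
    (∫⁻ x, f x * g x ∂μ) ^ 2 ≤ (∫⁻ x, f x ^ 2 ∂μ) * ∫⁻ x, g x ^ 2 ∂μ := by
  have h := ENNReal.lintegral_mul_le_Lp_mul_Lq μ Real.HolderConjugate.two_two hf hg
  have h2 := pow_le_pow_left' h 2
  refine h2.trans_eq ?_
  rw [mul_pow]
  simp only [← ENNReal.rpow_natCast, ← ENNReal.rpow_mul]
  simp

/-- An integrable function is bounded in `L²` by its Fourier transform. -/
lemma eLpNorm_two_le_fourier {f : E3 → ℂ} (hf : Integrable f) :
    eLpNorm f 2 volume ≤ eLpNorm (𝓕 f) 2 volume := by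
  by_cases htop : eLpNorm (𝓕 f) 2 volume = ⊤
  · simp [htop]
  have hcont : Continuous (𝓕 f) :=
    VectorFourier.fourierIntegral_continuous continuous_fourierChar continuous_inner hf
  have hmem : MemLp (𝓕 f) 2 volume := ⟨hcont.aestronglyMeasurable, lt_top_iff_ne_top.2 htop⟩
  set G : Lp ℂ 2 (volume : Measure E3) := 𝓕⁻ (hmem.toLp _) with hG
  have hdist := Lp.fourierInv_toTemperedDistribution_eq (hmem.toLp _)
  have key : ∀ φ : 𝓢(E3, ℂ), ∫ x, φ x • f x = ∫ x, φ x • G x := by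
    intro φ
    have h1 := congrArg (fun T => T φ) hdist
    simp only [TemperedDistribution.fourierInv_apply, Lp.toTemperedDistribution_apply] at h1
    rw [← hG] at h1
    rw [← h1]
    have h2 : ∫ x, 𝓕⁻ φ x • (hmem.toLp _) x = ∫ x, 𝓕⁻ φ x • 𝓕 f x := by
      apply integral_congr_ae
      filter_upwards [hmem.coeFn_toLp] with x hx
      rw [hx]
    rw [h2]
    have h3 := VectorFourier.integral_fourierIntegral_smul_eq_flip (L := innerₗ E3)
      continuous_fourierChar continuous_inner hf (𝓕⁻ φ).integrable (μ := volume) (ν := volume)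
    have h4 : ∀ x, VectorFourier.fourierIntegral 𝐞 volume (innerₗ E3).flip
        (⇑(𝓕⁻ φ : 𝓢(E3, ℂ))) x = φ x := by
      intro x
      have : 𝓕 (𝓕⁻ φ) x = φ x := by rw [FourierTransform.fourier_fourierInv_eq]
      rw [← this, SchwartzMap.fourier_coe, flip_innerₗ]
      rfl
    simp only [h4] at h3
    simp only [smul_eq_mul] at h3 ⊢
    simp only [mul_comm (φ _), mul_comm (𝓕⁻ φ _)]
    exact h3.symm
  have hae : ∀ᵐ x, f x = G x := by
    apply ae_eq_of_integral_contDiff_smul_eq hf.locallyIntegrable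
      ((Lp.memLp G).locallyIntegrable (by norm_num))
    intro g hg1 hg2
    have hc : HasCompactSupport (fun x => (g x : ℂ)) := hg2.comp_left (g := Complex.ofReal) rfl
    have hd : ContDiff ℝ ((⊤ : ℕ∞) : WithTop ℕ∞) (fun x => (g x : ℂ)) :=
      Complex.ofRealCLM.contDiff.comp hg1
    have := key (hc.toSchwartzMap hd)
    simpa using this
  rw [eLpNorm_congr_ae hae]
  have h5 : ‖G‖ = ‖hmem.toLp _‖ := by
    rw [← Lp.norm_fourier_eq G, hG, FourierTransform.fourier_fourierInv_eq]
  rw [← Lp.enorm_def, ← ofReal_norm, h5, Lp.norm_toLp, ENNReal.ofReal_toReal htop]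

lemma continuous_coe_fourierChar : Continuous fun r : ℝ => (𝐞 r : ℂ) :=
  continuous_induced_dom.comp continuous_fourierChar

/-- Integrability of a translated kernel against an integrable weight and a bounded phase. -/
lemma integrable_translate {P G : Type*} [MeasurableSpace P] (μ : Measure P) [SFinite μ]
    [NormedAddCommGroup G] [MeasurableSpace G] [BorelSpace G] [SecondCountableTopology G]
    (ν : Measure G) [SFinite ν] [ν.IsAddRightInvariant]
    {κ : P → ℂ} (hκ : Integrable κ μ) {h : G → ℂ} (hh : Integrable h ν)
    {a : P → G} (ha : Measurable a) {t : P × G → ℝ} (ht : Measurable t) :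
    Integrable (fun q : P × G => (𝐞 (t q) : ℂ) * (κ q.1 * h (q.2 - a q.1))) (μ.prod ν) := by
  have hmp : MeasurePreserving (fun q : P × G => (q.1, q.2 - a q.1)) (μ.prod ν) (μ.prod ν) :=
    (MeasurePreserving.id μ).skew_product (g := fun p x => x - a p)
      (by simp only [Function.uncurry_def]; fun_prop)
      (Filter.Eventually.of_forall fun p => (measurePreserving_sub_right ν (a p)).map_eq)
  have h1 := hmp.integrable_comp_of_integrable (hκ.mul_prod hh)
  refine h1.bdd_mul (c := 1) ?_ ?_
  · exact (continuous_coe_fourierChar.measurable.comp ht).aestronglyMeasurable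
  · exact Filter.Eventually.of_forall fun q => (Circle.norm_coe _).le

/-- The complexification of a real Schwartz function. -/
def complexify (E : 𝓢(E3, ℝ)) : 𝓢(E3, ℂ) :=
  SchwartzMap.bilinLeftCLM (ContinuousLinearMap.lsmul ℝ ℝ)
    (Function.HasTemperateGrowth.const (E := E3) (1 : ℂ)) E

lemma complexify_apply (E : 𝓢(E3, ℝ)) (x : E3) : complexify E x = (E x : ℂ) := by
  simp [complexify]

/-- The velocity slice `v ↦ u(x, v)` of a Schwartz function on phase space. -/
def slice (u : 𝓢(E3 × E3, ℝ)) (x : E3) : 𝓢(E3, ℂ) :=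
  complexify (SchwartzMap.compCLM ℝ (g := fun v : E3 => (x, v)) (by
      have h : Function.HasTemperateGrowth
          (fun v : E3 => (x, (0 : E3)) + ContinuousLinearMap.inr ℝ E3 E3 v) :=
        (Function.HasTemperateGrowth.const _).add
          (ContinuousLinearMap.inr ℝ E3 E3).hasTemperateGrowth
      simpa using h)
    ⟨1, 1, fun v => by
      have : ‖v‖ ≤ ‖(x, v)‖ := le_max_right _ _
      simp only [pow_one, one_mul]
      linarith⟩ u)

lemma slice_apply (u : 𝓢(E3 × E3, ℝ)) (x v : E3) : slice u x v = (u (x, v) : ℂ) := by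
  rw [slice, complexify_apply]
  rfl

/-- Product of Lebesgue measure on `(-1/2, 1/2]` with Lebesgue measure on frequency space. -/
def paramMeasure : Measure (ℝ × E3) :=
  (volume.restrict (Set.Ioc (-(1/2) : ℝ) (1/2))).prod volume

instance : SFinite paramMeasure := by
  unfold paramMeasure
  infer_instance

lemma integrable_fourier_snd (f : 𝓢(E3, ℂ)) :
    Integrable (fun p : ℝ × E3 => 𝓕 f p.2) paramMeasure :=
  (𝓕 f).integrable.comp_snd _

lemma integrable_char_mul {P : Type*} [MeasurableSpace P] {μ : Measure P} {κ : P → ℂ}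
    (hκ : Integrable κ μ) {t : P → ℝ} (ht : Measurable t) :
    Integrable (fun p => (𝐞 (t p) : ℂ) * κ p) μ := by
  refine hκ.bdd_mul (c := 1) ?_ (Filter.Eventually.of_forall fun q => (Circle.norm_coe _).le)
  exact (continuous_coe_fourierChar.measurable.comp ht).aestronglyMeasurable

lemma eq_integral_fourier (f : 𝓢(E3, ℂ)) (y : E3) :
    f y = ∫ ξ : E3, (𝐞 ⟪ξ, y⟫ : ℂ) * 𝓕 f ξ := by
  have h : 𝓕⁻ (𝓕 f) y = f y := by rw [FourierTransform.fourierInv_fourier_eq]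
  rw [← h, SchwartzMap.fourierInv_coe, Real.fourierInv_eq]
  rfl

lemma fourier_eq_integral (f : E3 → ℂ) (y : E3) :
    𝓕 f y = ∫ v : E3, (𝐞 (-⟪v, y⟫) : ℂ) * f v := by
  rw [Real.fourier_eq]
  rfl

lemma coe_fourierChar_add (a b : ℝ) : (𝐞 (a + b) : ℂ) = 𝐞 a * 𝐞 b := by
  rw [AddChar.map_add_eq_mul, Circle.coe_mul]

/-- Fourier representation of the averaged kernel. -/
lemma Wscal_eq (E : 𝓢(E3, ℝ)) (x ζ : E3) :
    (Wscal E x ((2 * π) • ζ) : ℂ) =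
      ∫ p, (𝐞 ⟪p.2, x - (2 * π * p.1) • ζ⟫ : ℂ) * 𝓕 (complexify E) p.2 ∂paramMeasure := by
  rw [paramMeasure, integral_prod]
  · rw [Wscal, intervalIntegral.integral_of_le (by norm_num), ← integral_complex_ofReal]
    refine integral_congr_ae (Filter.Eventually.of_forall fun r => ?_)
    simp only
    rw [← eq_integral_fourier, complexify_apply, smul_smul, mul_comm r]
  · exact integrable_char_mul (integrable_fourier_snd _) (by fun_prop)

/-- The partial Fourier transform in Mathlib's normalization. -/
lemma fourierV_eq (u : 𝓢(E3 × E3, ℝ)) (x ζ : E3) :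
    fourierV u x ((2 * π) • ζ) = ((2 * π : ℝ) ^ (-(3:ℝ)/2) : ℝ) * 𝓕 (slice u x) ζ := by
  rw [fourierV, SchwartzMap.fourier_coe, fourier_eq_integral]
  congr 1
  refine integral_congr_ae (Filter.Eventually.of_forall fun v => ?_)
  simp only [slice_apply, Real.fourierChar_apply, inner_smul_right]
  rw [mul_comm]
  congr 2
  push_cast
  ring

/-- `Γ[E]u` in Mathlib's normalization of the Fourier transform. -/
lemma GammaS_eq_integral (E : 𝓢(E3, ℝ)) (u : 𝓢(E3 × E3, ℝ)) (x v : E3) :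
    GammaS E u x v =
      ∫ ζ : E3, (Wscal E x ((2 * π) • ζ) : ℂ) * ((𝐞 ⟪ζ, v⟫ : ℂ) * 𝓕 (slice u x) ζ) := by
  have hpi : (0 : ℝ) < 2 * π := by positivity
  set c : ℝ := (2 * π : ℝ) ^ (-(3:ℝ)/2) with hc
  have hcc : c * c * (2 * π) ^ 3 = 1 := by
    rw [hc, ← Real.rpow_natCast, ← Real.rpow_add hpi, ← Real.rpow_add hpi]
    norm_num
  set F : E3 → ℂ := fun η => ((Wscal E x η : ℝ) : ℂ) * fourierV u x η *
      Complex.exp (Complex.I * ((⟪v, η⟫ : ℝ) : ℂ)) with hF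
  have hscale : ∫ η, F η = (2 * π) ^ 3 • ∫ ζ, F ((2 * π) • ζ) := by
    rw [Measure.integral_comp_smul_of_nonneg volume F (2 * π) (hR := hpi.le)]
    simp only [finrank_euclideanSpace, Fintype.card_fin]
    rw [smul_smul, mul_inv_cancel₀ (by positivity), one_smul]
  have hFz : ∀ ζ, F ((2 * π) • ζ) =
      c • ((Wscal E x ((2 * π) • ζ) : ℂ) * ((𝐞 ⟪ζ, v⟫ : ℂ) * 𝓕 (slice u x) ζ)) := by
    intro ζ
    simp only [hF, fourierV_eq, Real.fourierChar_apply, inner_smul_right, Complex.real_smul,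
      real_inner_comm v ζ]
    rw [← hc, show Complex.I * ((2 * π * ⟪v, ζ⟫ : ℝ) : ℂ) = ((2 * π * ⟪v, ζ⟫ : ℝ) : ℂ) * Complex.I
      from mul_comm _ _]
    ring
  rw [GammaS]
  change (c : ℂ) * ∫ η, F η = _
  rw [hscale]
  simp only [hFz, integral_smul]
  rw [smul_smul, ← Complex.real_smul, smul_smul,
    show c * ((2 * π) ^ 3 * c) = 1 by rw [← hcc]; ring, one_smul]

/-- `Γ[E]u` as a superposition of translates of `u` in the velocity variable. -/
lemma GammaS_eq (E : 𝓢(E3, ℝ)) (u : 𝓢(E3 × E3, ℝ)) (x v : E3) :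
    GammaS E u x v = ∫ p, (𝐞 ⟪p.2, x⟫ : ℂ) *
      (𝓕 (complexify E) p.2 * u (x, v - (2 * π * p.1) • p.2)) ∂paramMeasure := by
  rw [GammaS_eq_integral]
  simp only [Wscal_eq, ← integral_mul_const]
  rw [integral_integral_swap]
  · refine integral_congr_ae (Filter.Eventually.of_forall fun p => ?_)
    simp only
    rw [← slice_apply, eq_integral_fourier (slice u x), ← mul_assoc, ← integral_const_mul]
    refine integral_congr_ae (Filter.Eventually.of_forall fun ζ => ?_)
    simp only
    have h : (𝐞 ⟪p.2, x - (2 * π * p.1) • ζ⟫ : ℂ) * 𝐞 ⟪ζ, v⟫ =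
        𝐞 ⟪p.2, x⟫ * 𝐞 ⟪ζ, v - (2 * π * p.1) • p.2⟫ := by
      rw [← coe_fourierChar_add, ← coe_fourierChar_add]
      congr 2
      simp only [inner_sub_right, inner_smul_right, real_inner_comm ζ p.2]
      ring
    linear_combination (𝓕 (complexify E) p.2 * 𝓕 (slice u x) ζ) * h
  · have h1 := ((𝓕 (slice u x)).integrable (μ := volume)).mul_prod
      (integrable_fourier_snd (complexify E))
    have h2 := integrable_char_mul h1
      (t := fun q => ⟪q.2.2, x - (2 * π * q.2.1) • q.1⟫ + ⟪q.1, v⟫) (by fun_prop)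
    refine h2.congr (Filter.Eventually.of_forall fun q => ?_)
    simp only [Function.uncurry_def, coe_fourierChar_add]
    ring

instance : (volume : Measure (E3 × E3)).IsAddHaarMeasure :=
  inferInstanceAs ((volume : Measure E3).prod (volume : Measure E3)).IsAddHaarMeasure

lemma integrable_coe_schwartz (u : 𝓢(E3 × E3, ℝ)) :
    Integrable (fun z => (u z : ℂ)) (volume : Measure (E3 × E3)) :=
  (u.integrable (μ := volume)).ofReal

/-- `Γ[E]u` is integrable on phase space. -/
lemma integrable_GammaS (E : 𝓢(E3, ℝ)) (u : 𝓢(E3 × E3, ℝ)) :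
    Integrable (fun z : E3 × E3 => GammaS E u z.1 z.2) := by
  have h := integrable_translate paramMeasure (volume : Measure (E3 × E3))
    (integrable_fourier_snd (complexify E)) (integrable_coe_schwartz u)
    (a := fun p => ((0 : E3), (2 * π * p.1) • p.2)) (by fun_prop)
    (t := fun q => ⟪q.1.2, q.2.1⟫) (by fun_prop)
  refine h.integral_prod_right.congr (Filter.Eventually.of_forall fun z => ?_)
  simp only [GammaS_eq]
  refine integral_congr_ae (Filter.Eventually.of_forall fun p => ?_)
  simp [Prod.sub_def]

/-- The Fourier transform of `Γ[E]u` in the velocity variable. -/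
lemma fourier_GammaS (E : 𝓢(E3, ℝ)) (u : 𝓢(E3 × E3, ℝ)) (y ζ : E3) :
    ∫ v : E3, (𝐞 (-⟪v, ζ⟫) : ℂ) * GammaS E u y v =
      (Wscal E y ((2 * π) • ζ) : ℂ) * 𝓕 (slice u y) ζ := by
  have hint := integrable_translate paramMeasure (volume : Measure E3)
    (integrable_fourier_snd (complexify E)) ((slice u y).integrable (μ := volume))
    (a := fun p => (2 * π * p.1) • p.2) (by fun_prop)
    (t := fun q => -⟪q.2, ζ⟫ + ⟪q.1.2, y⟫) (by fun_prop)
  simp only [GammaS_eq, ← integral_const_mul]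
  rw [integral_integral_swap, Wscal_eq, ← integral_mul_const]
  · refine integral_congr_ae (Filter.Eventually.of_forall fun p => ?_)
    simp only
    rw [SchwartzMap.fourier_coe (slice u y), fourier_eq_integral,
      ← integral_sub_right_eq_self (fun v => (𝐞 (-⟪v, ζ⟫) : ℂ) * slice u y v)
        ((2 * π * p.1) • p.2), ← integral_const_mul]
    refine integral_congr_ae (Filter.Eventually.of_forall fun v => ?_)
    simp only [slice_apply]
    have h : (𝐞 (-⟪v, ζ⟫) : ℂ) * 𝐞 ⟪p.2, y⟫ =
        𝐞 ⟪p.2, y - (2 * π * p.1) • ζ⟫ * 𝐞 (-⟪v - (2 * π * p.1) • p.2, ζ⟫) := by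
      rw [← coe_fourierChar_add, ← coe_fourierChar_add]
      congr 2
      simp only [inner_sub_right, inner_sub_left, inner_smul_right, inner_smul_left,
        RCLike.conj_to_real]
      ring
    linear_combination (𝓕 (complexify E) p.2 * u (y, v - (2 * π * p.1) • p.2)) * h
  · refine hint.swap.congr (Filter.Eventually.of_forall fun q => ?_)
    simp only [Function.uncurry_def, coe_fourierChar_add, slice_apply, Function.comp_apply,
      Prod.fst_swap, Prod.snd_swap]
    ring

lemma measurePreserving_shear (s : ℝ) :
    MeasurePreserving (fun z : E3 × E3 => (z.1 - s • z.2, z.2)) := by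
  have h : MeasurePreserving (fun z : E3 × E3 => (z.1, z.2 - s • z.1))
      (volume.prod volume) (volume.prod volume) :=
    (MeasurePreserving.id volume).skew_product (g := fun p x => x - s • p)
      (by simp only [Function.uncurry_def]; fun_prop)
      (Filter.Eventually.of_forall fun p => (measurePreserving_sub_right volume (s • p)).map_eq)
  exact (Measure.measurePreserving_swap.comp h).comp Measure.measurePreserving_swap

/-- The macroscopic density of the freely transported `Γ[E]u`. -/
def density (E : E3 → ℝ) (u : E3 × E3 → ℝ) (s : ℝ) (x : E3) : ℂ :=
  ∫ v : E3, GammaS E u (x - s • v) v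

lemma integrable_transport (E : 𝓢(E3, ℝ)) (u : 𝓢(E3 × E3, ℝ)) (s : ℝ) :
    Integrable (fun z : E3 × E3 => GammaS E u (z.1 - s • z.2) z.2) :=
  (measurePreserving_shear s).integrable_comp_of_integrable (integrable_GammaS E u)

lemma integrable_density (E : 𝓢(E3, ℝ)) (u : 𝓢(E3 × E3, ℝ)) (s : ℝ) :
    Integrable (density E u s) :=
  (integrable_transport E u s).integral_prod_left

/-- The Fourier transform of the density at `k` only sees the frequency `s k` in velocity. -/
lemma fourier_density (E : 𝓢(E3, ℝ)) (u : 𝓢(E3 × E3, ℝ)) (s : ℝ) (k : E3) :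
    𝓕 (density E u s) k =
      ∫ y : E3, (𝐞 (-⟪y, k⟫) : ℂ) *
        ((Wscal E y ((2 * π) • s • k) : ℂ) * 𝓕 (slice u y) (s • k)) := by
  let F : E3 × E3 → ℂ := fun z =>
    (𝐞 (-⟪z.1, k⟫ + -⟪z.2, s • k⟫) : ℂ) * GammaS E u z.1 z.2
  have hF : Integrable F := integrable_char_mul (integrable_GammaS E u) (by fun_prop)
  have hFs : Integrable (fun z : E3 × E3 => F (z.1 - s • z.2, z.2)) :=
    (measurePreserving_shear s).integrable_comp_of_integrable hF
  have hphase : ∀ x v : E3, -⟪x - s • v, k⟫ + -⟪v, s • k⟫ = -⟪x, k⟫ := by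
    intro x v
    simp only [inner_sub_left, inner_smul_right, inner_smul_left, RCLike.conj_to_real]
    ring
  calc 𝓕 (density E u s) k
      = ∫ x : E3, ∫ v : E3, F (x - s • v, v) := by
        rw [fourier_eq_integral]
        refine integral_congr_ae (Filter.Eventually.of_forall fun x => ?_)
        simp only [density, F, hphase, integral_const_mul]
    _ = ∫ z : E3 × E3, F (z.1 - s • z.2, z.2) := (integral_prod _ hFs).symm
    _ = ∫ z : E3 × E3, F z := by
        have h := integral_map (μ := (volume : Measure (E3 × E3)))
          (measurePreserving_shear s).measurable.aemeasurable (f := F)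
          (by rw [(measurePreserving_shear s).map_eq]; exact hF.aestronglyMeasurable)
        rw [(measurePreserving_shear s).map_eq] at h
        exact h.symm
    _ = ∫ y : E3, ∫ v : E3, F (y, v) := integral_prod _ hF
    _ = _ := by
        refine integral_congr_ae (Filter.Eventually.of_forall fun y => ?_)
        simp only [F, coe_fourierChar_add, mul_assoc, integral_const_mul, fourier_GammaS]

lemma lintegral_comp_smul_E3 {s : ℝ} (hs : 0 < s) (f : E3 → ℝ≥0∞) :
    ∫⁻ x, f (s • x) = ENNReal.ofReal ((s ^ 3)⁻¹) * ∫⁻ x, f x := by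
  have h := (Homeomorph.smul
    (Units.mk0 s hs.ne')).toMeasurableEquiv.measurableEmbedding.lintegral_map
    (μ := (volume : Measure E3)) f
  have hm : Measure.map (fun x : E3 => s • x) volume = _ := Measure.map_addHaar_smul volume hs.ne'
  change ∫⁻ x, f x ∂(Measure.map (fun x : E3 => s • x) volume) = ∫⁻ x, f (s • x) at h
  rw [← h, hm, lintegral_smul_measure, finrank_euclideanSpace, Fintype.card_fin, abs_of_pos
    (by positivity), smul_eq_mul]

/-- The averaged kernel is bounded in `L²` uniformly in the averaging direction. -/
lemma lintegral_Wscal_sq_le (E : 𝓢(E3, ℝ)) (η : E3) :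
    ∫⁻ y, ‖(Wscal E y η : ℂ)‖ₑ ^ 2 ≤ ∫⁻ y, ‖E y‖ₑ ^ 2 := by
  set I : Measure ℝ := volume.restrict (Set.Ioc (-(1/2) : ℝ) (1/2)) with hI
  have hI1 : ∫⁻ _, 1 ∂I = 1 := by
    simp only [lintegral_one, hI, Measure.restrict_apply_univ, Real.volume_Ioc]
    norm_num
  have hcont : Continuous fun q : E3 × ℝ => ‖E (q.1 - q.2 • η)‖ₑ ^ 2 := by
    have := E.continuous
    fun_prop
  have h1 : ∀ y, ‖(Wscal E y η : ℂ)‖ₑ ^ 2 ≤ ∫⁻ r, ‖E (y - r • η)‖ₑ ^ 2 ∂I := by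
    intro y
    have hm : Measurable fun r : ℝ => ‖E (y - r • η)‖ₑ := by
      have := E.continuous
      exact Continuous.measurable (by fun_prop)
    calc ‖(Wscal E y η : ℂ)‖ₑ ^ 2 ≤ (∫⁻ r, ‖E (y - r • η)‖ₑ * 1 ∂I) ^ 2 := by
          simp only [mul_one]
          gcongr
          rw [Wscal, intervalIntegral.integral_of_le (by norm_num), ← integral_complex_ofReal]
          refine (enorm_integral_le_lintegral_enorm _).trans_eq ?_
          refine lintegral_congr fun r => ?_
          rw [← ofReal_norm, ← ofReal_norm, Complex.norm_real]
      _ ≤ (∫⁻ r, ‖E (y - r • η)‖ₑ ^ 2 ∂I) * ∫⁻ _, 1 ^ 2 ∂I :=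
          sq_lintegral_mul_le I hm.aemeasurable aemeasurable_const
      _ = _ := by rw [one_pow, hI1, mul_one]
  calc ∫⁻ y, ‖(Wscal E y η : ℂ)‖ₑ ^ 2
      ≤ ∫⁻ y, ∫⁻ r, ‖E (y - r • η)‖ₑ ^ 2 ∂I := lintegral_mono h1
    _ = ∫⁻ r, (∫⁻ y, ‖E (y - r • η)‖ₑ ^ 2) ∂I :=
        lintegral_lintegral_swap hcont.measurable.aemeasurable
    _ = ∫⁻ _, (∫⁻ y, ‖E y‖ₑ ^ 2) ∂I :=
        lintegral_congr fun r => lintegral_sub_right_eq_self (fun y => ‖E y‖ₑ ^ 2) (r • η)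
    _ = ∫⁻ y, ‖E y‖ₑ ^ 2 := by
        rw [lintegral_const, ← lintegral_one, hI1, mul_one]

lemma measurable_fourier_slice (u : 𝓢(E3 × E3, ℝ)) :
    Measurable fun q : E3 × E3 => 𝓕 (slice u q.1) q.2 := by
  have h : StronglyMeasurable fun q : E3 × E3 =>
      ∫ v : E3, (𝐞 (-⟪v, q.2⟫) : ℂ) * (u (q.1, v) : ℂ) := by
    refine StronglyMeasurable.integral_prod_right
      (f := fun (q : E3 × E3) (v : E3) => (𝐞 (-⟪v, q.2⟫) : ℂ) * (u (q.1, v) : ℂ)) ?_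
    have h1 := continuous_coe_fourierChar
    have h2 := u.continuous
    refine Continuous.stronglyMeasurable ?_
    simp only [Function.uncurry_def]
    exact (h1.comp (by fun_prop)).mul (Complex.continuous_ofReal.comp (h2.comp (by fun_prop)))
  convert h.measurable using 2 with q
  rw [SchwartzMap.fourier_coe, fourier_eq_integral]
  simp only [slice_apply]

lemma lintegral_fourier_sq (f : 𝓢(E3, ℂ)) : ∫⁻ ζ, ‖𝓕 f ζ‖ₑ ^ 2 = ∫⁻ v, ‖f v‖ₑ ^ 2 := by
  have h := SchwartzMap.norm_fourier_toL2_eq f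
  rw [SchwartzMap.norm_toLp, SchwartzMap.norm_toLp, ENNReal.toReal_eq_toReal_iff'
    ((𝓕 f).memLp 2 volume).eLpNorm_ne_top (f.memLp 2 volume).eLpNorm_ne_top] at h
  rw [← eLpNorm_two_sq, ← eLpNorm_two_sq, h]

/-- Plancherel in the velocity variable, with the frequency rescaled by `s`. -/
lemma lintegral_fourier_slice_sq (u : 𝓢(E3 × E3, ℝ)) {s : ℝ} (hs : 0 < s) :
    ∫⁻ k, ∫⁻ y, ‖𝓕 (slice u y) (s • k)‖ₑ ^ 2 =
      ENNReal.ofReal ((s ^ 3)⁻¹) * ∫⁻ z, ‖u z‖ₑ ^ 2 := by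
  have hm : Measurable fun q : E3 × E3 => ‖𝓕 (slice u q.2) (s • q.1)‖ₑ ^ 2 :=
    (((measurable_fourier_slice u).comp
      (f := fun q : E3 × E3 => (q.2, s • q.1)) (by fun_prop)).enorm).pow_const 2
  have hu : Continuous fun z => ‖u z‖ₑ ^ 2 := by
    have := u.continuous
    fun_prop
  have hslice : ∀ y v, ‖slice u y v‖ₑ = ‖u (y, v)‖ₑ := by
    intro y v
    rw [slice_apply, ← ofReal_norm, ← ofReal_norm, Complex.norm_real]
  rw [lintegral_lintegral_swap hm.aemeasurable]
  calc ∫⁻ y, ∫⁻ k, ‖𝓕 (slice u y) (s • k)‖ₑ ^ 2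
      = ∫⁻ y, ENNReal.ofReal ((s ^ 3)⁻¹) * ∫⁻ v, ‖u (y, v)‖ₑ ^ 2 := by
        refine lintegral_congr fun y => ?_
        rw [lintegral_comp_smul_E3 hs (fun k => ‖𝓕 (slice u y) k‖ₑ ^ 2), lintegral_fourier_sq]
        simp only [hslice]
    _ = ENNReal.ofReal ((s ^ 3)⁻¹) * ∫⁻ y, ∫⁻ v, ‖u (y, v)‖ₑ ^ 2 :=
        lintegral_const_mul' _ _ ENNReal.ofReal_ne_top
    _ = _ := by
        rw [← lintegral_prod _ hu.measurable.aemeasurable]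
        rfl

lemma enorm_fourier_density_sq_le (E : 𝓢(E3, ℝ)) (u : 𝓢(E3 × E3, ℝ)) (s : ℝ) (k : E3) :
    ‖𝓕 (density E u s) k‖ₑ ^ 2 ≤
      (∫⁻ y, ‖E y‖ₑ ^ 2) * ∫⁻ y, ‖𝓕 (slice u y) (s • k)‖ₑ ^ 2 := by
  have hW : Measurable fun y => (Wscal E y ((2 * π) • s • k) : ℂ) := by
    have : StronglyMeasurable fun y : E3 => ∫ r in Set.Ioc (-(1/2) : ℝ) (1/2),
        E (y - r • (2 * π) • s • k) := by
      refine StronglyMeasurable.integral_prod_right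
        (f := fun (y : E3) (r : ℝ) => E (y - r • (2 * π) • s • k)) ?_
      refine Continuous.stronglyMeasurable ?_
      simp only [Function.uncurry_def]
      exact E.continuous.comp (by fun_prop)
    simp only [Wscal, intervalIntegral.integral_of_le (show (-(1/2) : ℝ) ≤ 1/2 by norm_num)]
    exact Complex.measurable_ofReal.comp this.measurable
  have hA : Measurable fun y => 𝓕 (slice u y) (s • k) :=
    (measurable_fourier_slice u).comp (f := fun y : E3 => (y, s • k)) (by fun_prop)
  calc ‖𝓕 (density E u s) k‖ₑ ^ 2
      ≤ (∫⁻ y, ‖(Wscal E y ((2 * π) • s • k) : ℂ)‖ₑ * ‖𝓕 (slice u y) (s • k)‖ₑ) ^ 2 := by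
        rw [fourier_density]
        gcongr
        refine (enorm_integral_le_lintegral_enorm _).trans_eq ?_
        refine lintegral_congr fun y => ?_
        rw [enorm_mul, enorm_mul, ← ofReal_norm (𝐞 (-⟪y, k⟫) : ℂ), Circle.norm_coe,
          ENNReal.ofReal_one, one_mul]
    _ ≤ _ := sq_lintegral_mul_le _ hW.enorm.aemeasurable hA.enorm.aemeasurable
    _ ≤ _ := mul_le_mul' (lintegral_Wscal_sq_le E _) le_rfl

end Auxiliary

/-- Lemma 4.6 (dispersive estimate):
`‖∫ (Γ[E]u)(x−sv,v) dv‖_{L²_x} ≤ C s^{−3/2} ‖E‖_{L²} ‖u‖_{L²}`. -/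
theorem gamma_dispersive_estimate :
    ∃ C : ℝ, 0 < C ∧
      ∀ E : SchwartzMap E3 ℝ, ∀ u : SchwartzMap (E3 × E3) ℝ, ∀ s : ℝ, 0 < s →
        eLpNorm (fun x : E3 => ∫ v : E3, GammaS (⇑E) (⇑u) (x - s • v) v) 2 volume ≤
          ENNReal.ofReal (C * s ^ (-(3:ℝ)/2)) * eLpNorm (⇑E) 2 volume *
            eLpNorm (⇑u) 2 volume := by
  refine ⟨1, one_pos, fun E u s hs => ?_⟩
  refine (eLpNorm_two_le_fourier (integrable_density E u s)).trans ?_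
  rw [← ENNReal.pow_le_pow_left_iff two_ne_zero, mul_pow, mul_pow, eLpNorm_two_sq,
    eLpNorm_two_sq, eLpNorm_two_sq]
  have hpow : ENNReal.ofReal (1 * s ^ (-(3:ℝ)/2)) ^ 2 = ENNReal.ofReal ((s ^ 3)⁻¹) := by
    rw [← ENNReal.ofReal_pow (by positivity), one_mul, ← Real.rpow_natCast, ← Real.rpow_mul hs.le,
      ← Real.rpow_natCast s 3, ← Real.rpow_neg hs.le]
    norm_num
  have hE : ∫⁻ y, ‖E y‖ₑ ^ 2 ≠ ⊤ := by
    rw [← eLpNorm_two_sq]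
    exact ENNReal.pow_ne_top (E.memLp 2 volume).eLpNorm_ne_top
  refine (lintegral_mono (enorm_fourier_density_sq_le E u s)).trans_eq ?_
  rw [lintegral_const_mul' _ _ hE, lintegral_fourier_slice_sq u hs, hpow]
  ring

end
end
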